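/- arXiv:1809.07584 — 8 statements merged into one kernel-verified Lean document; each statement's English description precedes it below -/
import Mathlib

section
/- Let α be a real number with 0 ≤ α ≤ 1, and let B be a nonempty finite subset of ℕ. Then there exists a set A ⊆ ℕ such that the asymptotic density of the sumset A + B exists and equals α. -/
open Filter Pointwise

/-- Counting function: `X(n) = |X ∩ [1, n]|`. -/
noncomputable def countUpTo (X : Set ℕ) (n : ℕ) : ℕ := (X ∩ Set.Icc 1 n).ncard

/-- The asymptotic density of `X` exists and equals `α`. -/
def HasDensity (X : Set ℕ) (α : ℝ) : Prop :=
  Tendsto (fun n : ℕ => (countUpTo X n : ℝ) / n) atTop (nhds α)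

/-- Lower asymptotic density. -/
noncomputable def lowerDensity (X : Set ℕ) : ℝ :=
  liminf (fun n : ℕ => (countUpTo X n : ℝ) / n) atTop

/-- Upper asymptotic density. -/
noncomputable def upperDensity (X : Set ℕ) : ℝ :=
  limsup (fun n : ℕ => (countUpTo X n : ℝ) / n) atTop

/-- The `j`-fold sumset `jA := {x₁ + ⋯ + x_j : xᵢ ∈ A}`. -/
def foldSum (j : ℕ) (A : Set ℕ) : Set ℕ :=
  {x | ∃ f : Fin j → ℕ, (∀ i, f i ∈ A) ∧ x = ∑ i, f i}

open Classical in
noncomputable def greedySeq (α : ℝ) (B : Finset ℕ) : ℕ → Finset ℕ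
  | 0 => ∅
  | n + 1 => if ((greedySeq α B n + B).card : ℝ) ≤ α * n then insert n (greedySeq α B n)
      else greedySeq α B n

lemma greedySeq_lt (α : ℝ) (B : Finset ℕ) (n : ℕ) : ∀ x ∈ greedySeq α B n, x < n := by
  induction n with
  | zero => simp [greedySeq]
  | succ n ih =>
    intro x hx
    rw [greedySeq] at hx
    split_ifs at hx
    · rcases Finset.mem_insert.1 hx with h | h
      · omega
      · have := ih x h
        omega
    · have := ih x hx
      omega

lemma greedySeq_mono (α : ℝ) (B : Finset ℕ) : Monotone (greedySeq α B) := by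
  refine monotone_nat_of_le_succ fun n => ?_
  rw [greedySeq]
  split_ifs
  · exact Finset.subset_insert _ _
  · exact le_rfl

lemma greedySeq_stable (α : ℝ) (B : Finset ℕ) (n m x : ℕ) (hx : x ∈ greedySeq α B m)
    (hxn : x < n) : x ∈ greedySeq α B n := by
  induction m with
  | zero => simp [greedySeq] at hx
  | succ m ih =>
    rcases le_total (m + 1) n with h | h
    · exact greedySeq_mono α B h hx
    rw [greedySeq] at hx
    split_ifs at hx
    · rcases Finset.mem_insert.1 hx with h' | h'
      · have : n = m + 1 := by omega
        subst this
        rw [greedySeq, if_pos (by assumption)]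
        exact hx
      · exact ih h'
    · exact ih hx

lemma greedySeq_card (α : ℝ) (hα0 : 0 ≤ α) (hα1 : α ≤ 1) (B : Finset ℕ) (hB : B.Nonempty)
    (n : ℕ) : α * n - 1 ≤ ((greedySeq α B n + B).card : ℝ) ∧
      ((greedySeq α B n + B).card : ℝ) ≤ α * n + B.card := by
  induction n with
  | zero => simp [greedySeq]
  | succ n ih =>
    obtain ⟨h1, h2⟩ := ih
    rw [greedySeq]
    push_cast
    split_ifs with h
    · have e : insert n (greedySeq α B n) + B = (({n} : Finset ℕ) + B) ∪ (greedySeq α B n + B) := by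
        rw [Finset.insert_eq, Finset.union_add]
      have hu : (insert n (greedySeq α B n) + B).card ≤ B.card + (greedySeq α B n + B).card := by
        rw [e]
        refine (Finset.card_union_le _ _).trans ?_
        simp
      have hl : (greedySeq α B n + B).card + 1 ≤ (insert n (greedySeq α B n) + B).card := by
        have hn : n + B.max' hB ∉ greedySeq α B n + B := by
          intro hm
          obtain ⟨a, ha, b, hb, hab⟩ := Finset.mem_add.1 hm
          have := greedySeq_lt α B n a ha
          have := B.le_max' b hb
          omega
        rw [← Finset.card_insert_of_notMem hn]
        refine Finset.card_le_card (Finset.insert_subset ?_ ?_)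
        · exact Finset.add_mem_add (Finset.mem_insert_self _ _) (B.max'_mem hB)
        · exact Finset.add_subset_add_right (Finset.subset_insert _ _)
      have hu' : ((insert n (greedySeq α B n) + B).card : ℝ)
        ≤ B.card + (greedySeq α B n + B).card := by exact_mod_cast hu
      have hl' : ((greedySeq α B n + B).card : ℝ) + 1 ≤ (insert n (greedySeq α B n) + B).card := by
        exact_mod_cast hl
      constructor <;> linarith
    · constructor <;> linarith

theorem stmt0 (α : ℝ) (hα0 : 0 ≤ α) (hα1 : α ≤ 1) (B : Finset ℕ) (hB : B.Nonempty) :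
    ∃ A : Set ℕ, HasDensity (A + (B : Set ℕ)) α := by
  set A : Set ℕ := {x | ∃ m, x ∈ greedySeq α B m} with hA
  refine ⟨A, ?_⟩
  set M := B.max' hB
  have key : ∀ n : ℕ, |(countUpTo (A + (B : Set ℕ)) n : ℝ) - α * n| ≤ M + B.card + 3 := by
    intro n
    obtain ⟨h1, h2⟩ := greedySeq_card α hα0 hα1 B hB (n + 1)
    push_cast at h1 h2
    have fin : ((A + (B : Set ℕ)) ∩ Set.Icc 1 n).Finite := (Set.finite_Icc 1 n).inter_of_right _
    have hu : countUpTo (A + (B : Set ℕ)) n ≤ (greedySeq α B (n + 1) + B).card := by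
      rw [countUpTo, ← Set.ncard_coe_finset]
      refine Set.ncard_le_ncard ?_ (Finset.finite_toSet _)
      rintro x ⟨hx, hx1, hxn⟩
      obtain ⟨a, ⟨m, ha⟩, b, hb, rfl⟩ := Set.mem_add.1 hx
      exact Finset.add_mem_add (greedySeq_stable α B (n + 1) m a ha (by omega)) hb
    have hl : (greedySeq α B (n + 1) + B).card ≤ countUpTo (A + (B : Set ℕ)) n + (M + 1) := by
      have hsub : ((greedySeq α B (n + 1) + B : Finset ℕ) : Set ℕ) ⊆
          ((A + (B : Set ℕ)) ∩ Set.Icc 1 n) ∪ ((insert 0 (Finset.Ioc n (n + M)) : Finset ℕ) : Set ℕ) := by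
        intro x hx
        obtain ⟨a, ha, b, hb, rfl⟩ := Finset.mem_add.1 (Finset.mem_coe.1 hx)
        have h3 := greedySeq_lt α B (n + 1) a ha
        have h4 : b ≤ M := B.le_max' b hb
        by_cases hc : 1 ≤ a + b ∧ a + b ≤ n
        · exact Or.inl ⟨Set.add_mem_add ⟨_, ha⟩ hb, hc⟩
        · right
          simp only [Finset.coe_insert, Finset.coe_Ioc, Set.mem_insert_iff, Set.mem_Ioc]
          omega
      rw [countUpTo, ← Set.ncard_coe_finset]
      refine (Set.ncard_le_ncard hsub (fin.union (Finset.finite_toSet _))).trans ?_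
      refine (Set.ncard_union_le _ _).trans ?_
      rw [Set.ncard_coe_finset]
      have := Finset.card_insert_le 0 (Finset.Ioc n (n + M))
      simp only [Nat.card_Ioc] at this
      omega
    have hu' : (countUpTo (A + (B : Set ℕ)) n : ℝ) ≤ (greedySeq α B (n + 1) + B).card := by
      exact_mod_cast hu
    have hl' : ((greedySeq α B (n + 1) + B).card : ℝ) ≤
        countUpTo (A + (B : Set ℕ)) n + (M + 1) := by exact_mod_cast hl
    have : (0 : ℝ) ≤ M := Nat.cast_nonneg _
    have : (0 : ℝ) ≤ B.card := Nat.cast_nonneg _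
    rw [abs_le]
    constructor <;> linarith
  rw [HasDensity, tendsto_iff_norm_sub_tendsto_zero]
  refine squeeze_zero' (Eventually.of_forall fun _ => norm_nonneg _) ?_
    (tendsto_const_div_atTop_nhds_zero_nat ((M : ℝ) + B.card + 3))
  filter_upwards [eventually_gt_atTop 0] with n hn
  have hn' : (0 : ℝ) < n := by exact_mod_cast hn
  have e : (countUpTo (A + (B : Set ℕ)) n : ℝ) / n - α =
      ((countUpTo (A + (B : Set ℕ)) n : ℝ) - α * n) / n := by
    field_simp
  rw [e, Real.norm_eq_abs, abs_div, abs_of_pos hn']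
  exact div_le_div_of_nonneg_right (key n) hn'.le
end

section
/- Let α be a real number with 0 ≤ α ≤ 1, and let k ≥ 2 be an integer. Then there exists a subset A of ℕ such that for every integer j with 1 ≤ j ≤ k, the asymptotic density of the j-fold sumset jA exists and equals jα/k. In particular, d(kA) = α. -/
open Filter Pointwise

lemma aux_indicator (u v : ℝ) :
    (if Int.fract u < Int.fract v then (1:ℝ) else 0)
      = Int.fract v - Int.fract u + Int.fract (u - v) := by
  have hu0 := Int.fract_nonneg u
  have hu1 := Int.fract_lt_one u
  have hv0 := Int.fract_nonneg v
  have hv1 := Int.fract_lt_one v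
  have hu := Int.floor_add_fract u
  have hv := Int.floor_add_fract v
  split_ifs with h
  · have : Int.fract (u - v) = Int.fract u - Int.fract v + 1 := by
      rw [Int.fract_eq_iff]
      refine ⟨by linarith, by linarith, ⌊u⌋ - ⌊v⌋ - 1, ?_⟩
      push_cast; linarith
    rw [this]; ring
  · have : Int.fract (u - v) = Int.fract u - Int.fract v := by
      rw [Int.fract_eq_iff]
      refine ⟨by linarith, by linarith, ⌊u⌋ - ⌊v⌋, ?_⟩
      push_cast; linarith
    rw [this]; ring

lemma aux_count (X : Set ℕ) [DecidablePred (· ∈ X)] (n : ℕ) :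
    (countUpTo X n : ℝ) = ∑ i ∈ Finset.range n, if (i + 1) ∈ X then (1:ℝ) else 0 := by
  have h : (countUpTo X n) = ∑ i ∈ Finset.range n, if (i + 1) ∈ X then 1 else 0 := by
    unfold countUpTo
    have : X ∩ Set.Icc 1 n = ((((Finset.range n).filter (fun i => i + 1 ∈ X)).image (· + 1) :
        Finset ℕ) : Set ℕ) := by
      ext x
      simp only [Set.mem_inter_iff, Set.mem_Icc, Finset.coe_image, Finset.coe_filter,
        Finset.mem_range, Set.mem_image, Set.mem_setOf_eq]
      constructor
      · rintro ⟨hx, h1, h2⟩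
        refine ⟨x - 1, ⟨by omega, ?_⟩, by omega⟩
        rwa [Nat.sub_add_cancel h1]
      · rintro ⟨y, ⟨hy, hyX⟩, rfl⟩
        exact ⟨hyX, by omega, by omega⟩
    rw [this, Set.ncard_coe_finset, Finset.card_image_of_injective _ (add_left_injective 1),
      Finset.card_filter]
  rw [h]; push_cast; rfl

lemma aux_tele (g : ℤ → ℝ) (h0 : ∀ z, 0 ≤ g z) (h1 : ∀ z, g z ≤ 1) (n m : ℕ) :
    |∑ i ∈ Finset.range n, (g ((i:ℤ) + 1 - m) - g ((i:ℤ) + 1))| ≤ m := by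
  induction m with
  | zero => simp
  | succ m ih =>
    have e : ∑ i ∈ Finset.range n, (g ((i:ℤ) + 1 - (m+1 : ℕ)) - g ((i:ℤ) + 1))
        = ∑ i ∈ Finset.range n, (g ((i:ℤ) + 1 - m) - g ((i:ℤ) + 1))
          + (g (0 - m) - g (n - m)) := by
      have t := Finset.sum_range_sub' (fun i : ℕ => g ((i:ℤ) - m)) n
      push_cast at t
      rw [← t, ← Finset.sum_add_distrib]
      refine Finset.sum_congr rfl fun i _ => ?_
      have : (i:ℤ) + 1 - ((m + 1 : ℕ) : ℤ) = i - m := by push_cast; ring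
      rw [this]; ring
    rw [e]
    refine (abs_add_le _ _).trans ?_
    push_cast
    refine add_le_add ih ?_
    rw [abs_le]
    constructor <;> linarith [h0 (0 - m), h1 (0 - m), h0 (n - m), h1 (n - m)]

def bohr (θ c : ℝ) : Set ℕ := {n | Int.fract ((n:ℝ) * θ) < c}

lemma bohr_base (θ : ℝ) (m : ℕ) :
    HasDensity (bohr θ (Int.fract ((m:ℝ) * θ))) (Int.fract ((m:ℝ) * θ)) := by
  classical
  set x := Int.fract ((m:ℝ) * θ) with hx
  have key : ∀ n : ℕ, |(countUpTo (bohr θ x) n : ℝ) - n * x| ≤ m := by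
    intro n
    have t := aux_tele (fun z : ℤ => Int.fract ((z:ℝ) * θ)) (fun z => Int.fract_nonneg _)
      (fun z => (Int.fract_lt_one _).le) n m
    convert t using 2
    rw [aux_count, sub_eq_iff_eq_add]
    have : (n:ℝ) * x = ∑ i ∈ Finset.range n, x := by simp
    rw [this, ← Finset.sum_add_distrib]
    refine Finset.sum_congr rfl fun i _ => ?_
    have a := aux_indicator (((i+1:ℕ):ℝ) * θ) ((m:ℝ) * θ)
    have e : (i + 1 ∈ bohr θ x) = (Int.fract (((i+1:ℕ):ℝ) * θ) < Int.fract ((m:ℝ) * θ)) := rfl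
    simp only [e]
    rw [a, ← sub_mul]
    push_cast
    rw [← hx]; ring
  unfold HasDensity
  rw [tendsto_iff_norm_sub_tendsto_zero]
  refine squeeze_zero' (Eventually.of_forall fun n => norm_nonneg _) ?_
    (tendsto_const_div_atTop_nhds_zero_nat (m:ℝ))
  filter_upwards [eventually_gt_atTop 0] with n hn
  have hn' : (0:ℝ) < n := by exact_mod_cast hn
  have : (countUpTo (bohr θ x) n : ℝ) / n - x = ((countUpTo (bohr θ x) n : ℝ) - n * x) / n := by
    field_simp
  rw [this, Real.norm_eq_abs, abs_div, abs_of_pos hn']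
  gcongr
  exact key n

lemma count_mono {X Y : Set ℕ} (h : X ⊆ Y) (n : ℕ) : countUpTo X n ≤ countUpTo Y n :=
  Set.ncard_le_ncard (Set.inter_subset_inter_left _ h) ((Set.finite_Icc 1 n).inter_of_right _)

lemma count_shift {L X : Set ℕ} (N : ℕ) (h : ∀ n ∈ L, N ≤ n → n ∈ X) (n : ℕ) :
    countUpTo L n ≤ countUpTo X n + N := by
  have h1 : L ∩ Set.Icc 1 n ⊆ (X ∩ Set.Icc 1 n) ∪ (Finset.range N : Finset ℕ) := by
    rintro x ⟨hx, hx'⟩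
    by_cases hN : N ≤ x
    · exact Or.inl ⟨h x hx hN, hx'⟩
    · right; simp; omega
  have h2 := Set.ncard_le_ncard h1
    (((Set.finite_Icc 1 n).inter_of_right _).union (Finset.finite_toSet _))
  refine h2.trans ((Set.ncard_union_le _ _).trans ?_)
  rw [Set.ncard_coe_finset, Finset.card_range]
  rfl

lemma density_squeeze (X : Set ℕ) (c : ℝ)
    (hL : ∀ ε > 0, ∃ L l N, HasDensity L l ∧ c - ε < l ∧ ∀ n ∈ L, N ≤ n → n ∈ X)
    (hU : ∀ ε > 0, ∃ U u, HasDensity U u ∧ u < c + ε ∧ X ⊆ U) : HasDensity X c := by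
  unfold HasDensity
  rw [tendsto_order]
  constructor
  · intro a ha
    obtain ⟨L, l, N, h1, h2, h3⟩ := hL (c - a) (by linarith)
    have t := h1.sub (tendsto_const_div_atTop_nhds_zero_nat (N:ℝ))
    filter_upwards [t.eventually_const_lt (show a < l - 0 by linarith)] with n hn
    refine hn.trans_le ?_
    rw [← sub_div]
    have : (countUpTo L n : ℝ) ≤ countUpTo X n + N := by exact_mod_cast count_shift N h3 n
    gcongr
    linarith
  · intro a ha
    obtain ⟨U, u, h1, h2, h3⟩ := hU (a - c) (by linarith)
    filter_upwards [h1.eventually_lt_const (show u < a by linarith)] with n hn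
    refine lt_of_le_of_lt ?_ hn
    gcongr
    exact count_mono h3 n

lemma fract_dense {θ : ℝ} (hθ : Irrational θ) {a b : ℝ} (ha : 0 ≤ a) (hab : a < b) (hb : b ≤ 1) :
    ∃ m : ℕ, a < Int.fract ((m:ℝ) * θ) ∧ Int.fract ((m:ℝ) * θ) < b := by
  have d : DenseRange (· • (θ : AddCircle (1:ℝ)) : ℕ → AddCircle (1:ℝ)) := by
    rw [← denseRange_zsmul_iff_nsmul, AddCircle.denseRange_zsmul_coe_iff]
    simpa using hθ
  have ho : IsOpen ((fun x : ℝ => (x : AddCircle (1:ℝ))) '' Set.Ioo a b) :=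
    QuotientAddGroup.isOpenMap_coe _ isOpen_Ioo
  obtain ⟨m, y, hy, hm⟩ := d.exists_mem_open ho ((Set.nonempty_Ioo.2 hab).image _)
  refine ⟨m, ?_⟩
  have : Int.fract ((m:ℝ) * θ) = y := by
    rw [Int.fract_eq_iff]
    refine ⟨by linarith [hy.1], by linarith [hy.2], ?_⟩
    have hm' : ((y:ℝ) : AddCircle (1:ℝ)) = ((m * θ : ℝ) : AddCircle (1:ℝ)) := by
      rw [← nsmul_eq_mul]; exact hm
    rw [QuotientAddGroup.eq] at hm'
    obtain ⟨z, hz⟩ := AddSubgroup.mem_zmultiples_iff.1 hm'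
    refine ⟨z, ?_⟩
    simp at hz
    linarith
  rw [this]; exact hy

lemma density_univ : HasDensity Set.univ 1 := by
  unfold HasDensity
  refine tendsto_const_nhds.congr' ?_
  filter_upwards [eventually_gt_atTop 0] with n hn
  have hn' : (n:ℝ) ≠ 0 := by positivity
  have : countUpTo Set.univ n = n := by
    unfold countUpTo
    rw [Set.univ_inter, ← Finset.coe_Icc, Set.ncard_coe_finset]; simp
  rw [this]; field_simp

lemma bohr_mono (θ : ℝ) {c d : ℝ} (h : c ≤ d) : bohr θ c ⊆ bohr θ d :=
  fun _ hn => lt_of_lt_of_le hn h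

lemma bohr_density {θ : ℝ} (hθ : Irrational θ) {c : ℝ} (h0 : 0 ≤ c) (h1 : c ≤ 1) :
    HasDensity (bohr θ c) c := by
  apply density_squeeze
  · intro ε hε
    have : ∃ m : ℕ, c - ε < Int.fract ((m:ℝ) * θ) ∧ Int.fract ((m:ℝ) * θ) ≤ c := by
      rcases h0.eq_or_lt with h | h
      · refine ⟨0, ?_⟩; simp; constructor <;> linarith
      · obtain ⟨m, hm, hm'⟩ := fract_dense hθ (le_max_right (c - ε) 0)
          (show max (c - ε) 0 < c from max_lt (by linarith) h) h1
        exact ⟨m, (le_max_left _ _).trans_lt hm, hm'.le⟩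
    obtain ⟨m, hm, hm'⟩ := this
    exact ⟨_, _, 0, bohr_base θ m, hm, fun n hn _ => bohr_mono θ hm' hn⟩
  · intro ε hε
    rcases h1.eq_or_lt with h | h
    · exact ⟨Set.univ, 1, density_univ, by linarith, Set.subset_univ _⟩
    · obtain ⟨m, hm, hm'⟩ := fract_dense hθ h0
          (show c < min (c + ε) 1 from lt_min (by linarith) h) (min_le_right _ _)
      exact ⟨_, _, bohr_base θ m, hm'.trans_le (min_le_left _ _), bohr_mono θ hm.le⟩

lemma fract_grid {θ : ℝ} (hθ : Irrational θ) {η : ℝ} (hη : 0 < η) :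
    ∃ N : ℕ, ∀ s : ℝ, 0 ≤ s → s < 1 → ∃ f ≤ N, Int.fract ((f:ℝ) * θ) ≤ s ∧
      s < Int.fract ((f:ℝ) * θ) + η := by
  obtain ⟨M, hM⟩ := exists_nat_gt (2 / η)
  have hM0 : (0:ℝ) < M := lt_trans (by positivity) hM
  have hM2 : 2 / (M:ℝ) < η := by
    rw [div_lt_iff₀ hη] at hM
    rw [div_lt_iff₀ hM0]; linarith
  have : ∀ i : ℕ, ∃ m : ℕ, i < M → ((i:ℝ) / M < Int.fract ((m:ℝ) * θ) ∧
      Int.fract ((m:ℝ) * θ) < ((i:ℝ) + 1) / M) := by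
    intro i
    by_cases hi : i < M
    · obtain ⟨m, hm⟩ := fract_dense hθ (show 0 ≤ (i:ℝ) / M by positivity)
        (show (i:ℝ) / M < ((i:ℝ) + 1) / M by gcongr; linarith)
        (by rw [div_le_one hM0]; exact_mod_cast hi)
      exact ⟨m, fun _ => hm⟩
    · exact ⟨0, fun h => absurd h hi⟩
  choose f hf using this
  refine ⟨(Finset.range M).sup f, fun s hs0 hs1 => ?_⟩
  have hfl := Nat.floor_le (show 0 ≤ s * M by positivity)
  have hlt := Nat.lt_floor_add_one (s * M)
  rcases hi : ⌊s * M⌋₊ with _ | i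
  · refine ⟨0, Nat.zero_le _, by simpa using hs0, ?_⟩
    rw [hi] at hlt
    simp at hlt ⊢
    have : s < 1 / M := by rw [lt_div_iff₀ hM0]; exact hlt
    have : 1 / (M:ℝ) ≤ 2 / M := by gcongr; norm_num
    linarith
  · rw [hi] at hfl hlt
    push_cast at hfl hlt
    have hiM : i < M := by
      have : (i:ℝ) < M := by nlinarith
      exact_mod_cast this
    obtain ⟨h1, h2⟩ := hf i hiM
    refine ⟨f i, Finset.le_sup (f := f) (Finset.mem_range.2 hiM), ?_, ?_⟩
    · refine h2.le.trans ?_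
      rw [div_le_iff₀ hM0]; exact hfl
    · have h3 : s < ((i:ℝ) + 1 + 1) / M := by rw [lt_div_iff₀ hM0]; exact hlt
      have h4 : ((i:ℝ) + 1 + 1) / M = i / M + 2 / M := by ring
      linarith

lemma foldSum_sub (θ β : ℝ) (j : ℕ) (hj : 1 ≤ j) :
    foldSum j (bohr θ β) ⊆ bohr θ (j * β) := by
  rintro x ⟨f, hf, rfl⟩
  have h1 : ∀ s : Finset (Fin j), Int.fract (((∑ i ∈ s, f i : ℕ):ℝ) * θ)
      ≤ ∑ i ∈ s, Int.fract ((f i : ℝ) * θ) := by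
    classical
    intro s
    induction s using Finset.induction_on with
    | empty => simp
    | insert a s ha ih =>
      rw [Finset.sum_insert ha, Finset.sum_insert ha]
      push_cast at ih ⊢
      rw [add_mul]
      exact (Int.fract_add_le _ _).trans (by linarith)
  refine (h1 Finset.univ).trans_lt ?_
  have h2 : ∑ i : Fin j, Int.fract ((f i : ℝ) * θ) < ∑ i : Fin j, β := by
    refine Finset.sum_lt_sum_of_nonempty ⟨⟨0, hj⟩, Finset.mem_univ _⟩ fun i _ => hf i
  simpa using h2

lemma sub_foldSum {θ β ε : ℝ} (hθ : Irrational θ) (j : ℕ) (hβ : β ≤ 1) (hε : 0 < ε) :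
    ∃ N : ℕ, ∀ n ∈ bohr θ ((j + 1 : ℕ) * β - ε), N ≤ n → n ∈ foldSum (j + 1) (bohr θ β) := by
  have hj : (0:ℝ) < (j:ℝ) + 1 := by positivity
  obtain ⟨N, hN⟩ := fract_grid hθ (show 0 < ε / ((j:ℝ) + 1) ^ 2 by positivity)
  refine ⟨j * N, fun n hn hnN => ?_⟩
  have ht : Int.fract ((n:ℝ) * θ) < ((j + 1 : ℕ) * β - ε) := hn
  push_cast at ht
  set t := Int.fract ((n:ℝ) * θ) with htd
  have ht0 : 0 ≤ t := Int.fract_nonneg _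
  obtain ⟨s, hs⟩ : ∃ s, t = (j + 1) * s := ⟨t / (j + 1), by field_simp⟩
  have hs0 : 0 ≤ s := by
    by_contra h; push Not at h; nlinarith
  have hsβ : s < β - ε / (j + 1) := by
    have : ε = (j + 1) * (ε / (j + 1)) := by field_simp
    rw [hs] at ht
    by_contra h; push Not at h; nlinarith
  have hε1 : 0 < ε / ((j:ℝ) + 1) := by positivity
  obtain ⟨f, hfN, hf1, hf2⟩ := hN s hs0 (by linarith)
  set x := Int.fract ((f:ℝ) * θ) with hx
  have hjf : j * f ≤ n := (Nat.mul_le_mul_left j hfN).trans hnN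
  have hb : s + j * (s - x) < β := by
    have e : ε / ((j:ℝ) + 1) = (j + 1) * (ε / ((j:ℝ) + 1) ^ 2) := by field_simp
    have : (j:ℝ) * (s - x) ≤ j * (ε / ((j:ℝ) + 1) ^ 2) := by gcongr; linarith
    have : 0 < ε / ((j:ℝ) + 1) ^ 2 := by positivity
    linarith
  have hfr : Int.fract (((n - j * f : ℕ) : ℝ) * θ) = s + j * (s - x) := by
    rw [Int.fract_eq_iff]
    have : 0 ≤ (j:ℝ) * (s - x) := mul_nonneg (by positivity) (by linarith)
    refine ⟨by linarith, by linarith, ⌊(n:ℝ) * θ⌋ - j * ⌊(f:ℝ) * θ⌋, ?_⟩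
    have a := Int.floor_add_fract ((n:ℝ) * θ)
    have b := Int.floor_add_fract ((f:ℝ) * θ)
    rw [← htd] at a
    rw [← hx] at b
    rw [Nat.cast_sub hjf]
    push_cast
    linear_combination (-1 : ℝ) * a + (j:ℝ) * b + hs
  refine ⟨Fin.cons (n - j * f) (fun _ => f), ?_, ?_⟩
  · intro i
    refine Fin.cases ?_ (fun i => ?_) i
    · simp only [Fin.cons_zero]
      show Int.fract _ < β
      rw [hfr]; exact hb
    · simp only [Fin.cons_succ]
      show Int.fract _ < β
      rw [← hx]; linarith
  · rw [Fin.sum_univ_succ]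
    simp
    omega

theorem stmt1 (α : ℝ) (hα0 : 0 ≤ α) (hα1 : α ≤ 1) (k : ℕ) (hk : 2 ≤ k) :
    ∃ A : Set ℕ, ∀ j : ℕ, 1 ≤ j → j ≤ k →
      HasDensity (foldSum j A) ((j : ℝ) * α / k) := by
  have hθ : Irrational (√2) := irrational_sqrt_two
  have hk0 : (0:ℝ) < k := by exact_mod_cast (by omega : 0 < k)
  have hk1 : (1:ℝ) ≤ k := by exact_mod_cast (by omega : 1 ≤ k)
  refine ⟨bohr (√2) (α / k), fun j hj hjk => ?_⟩
  have hβ0 : 0 ≤ α / k := by positivity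
  have hβ1 : α / k ≤ 1 := by rw [div_le_one hk0]; linarith
  rw [mul_div_assoc]
  have hc0 : 0 ≤ (j:ℝ) * (α / k) := by positivity
  have hc1 : (j:ℝ) * (α / k) ≤ 1 := by
    rw [← mul_div_assoc, div_le_one hk0]
    have : (j:ℝ) ≤ k := by exact_mod_cast hjk
    nlinarith
  apply density_squeeze
  · intro ε hε
    obtain ⟨i, rfl⟩ : ∃ i, j = i + 1 := ⟨j - 1, by omega⟩
    obtain ⟨N, hN⟩ := sub_foldSum hθ i hβ1 (half_pos hε)
    refine ⟨_, _, N, bohr_density hθ (le_max_right (((i + 1 : ℕ):ℝ) * (α / k) - ε / 2) 0)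
      (max_le (by linarith) (by norm_num)), lt_of_lt_of_le (by linarith) (le_max_left _ _), ?_⟩
    intro n hn hnN
    refine hN n ?_ hnN
    have hn' : Int.fract ((n:ℝ) * √2) < max _ _ := hn
    rcases lt_max_iff.1 hn' with h | h
    · exact h
    · exact absurd h (not_lt.2 (Int.fract_nonneg _))
  · intro ε hε
    exact ⟨_, _, bohr_density hθ hc0 hc1, by linarith, foldSum_sub _ _ j hj⟩
end

section
/- Let X be a subset of ℕ and θ a real number with θ ≥ 1. Define θ·X := {⌊θa⌋ : a ∈ X}. Then the lower asymptotic density of θ·X equals θ⁻¹ times the lower asymptotic density of X, and the upper asymptotic density of θ·X equals θ⁻¹ times the upper asymptotic density of X. -/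
open Filter Pointwise

theorem limsup_le_aux (v w : ℕ → ℝ) (hv : ∀ n, 0 ≤ v n) (hw : ∀ n, 0 ≤ w n ∧ w n ≤ 1)
    (h : Tendsto (fun n => v n - w n) atTop (nhds 0)) :
    limsup v atTop = limsup w atTop ∧ liminf v atTop = liminf w atTop := by
  have hd : ∀ ε > 0, ∀ᶠ n in atTop, v n ≤ w n + ε ∧ w n ≤ v n + ε := by
    intro ε hε
    filter_upwards [Metric.tendsto_nhds.1 h ε hε] with n hn
    rw [Real.dist_eq, sub_zero, abs_lt] at hn
    constructor <;> linarith [hn.1, hn.2]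
  have wa : IsBoundedUnder (· ≤ ·) atTop w := isBoundedUnder_of ⟨1, fun n => (hw n).2⟩
  have wb : IsBoundedUnder (· ≥ ·) atTop w := isBoundedUnder_of ⟨0, fun n => (hw n).1⟩
  have vb : IsBoundedUnder (· ≥ ·) atTop v := isBoundedUnder_of ⟨0, hv⟩
  have va : IsBoundedUnder (· ≤ ·) atTop v := by
    refine ⟨2, ?_⟩
    rw [eventually_map]
    filter_upwards [hd 1 one_pos] with n hn
    linarith [hn.1, (hw n).2]
  have hm : ∀ ε : ℝ, Monotone (fun x : ℝ => x + ε) := fun ε a b hab => by simpa using hab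
  have key : ∀ s t : ℕ → ℝ, IsBoundedUnder (· ≤ ·) atTop s → IsBoundedUnder (· ≥ ·) atTop s →
      IsBoundedUnder (· ≤ ·) atTop t → IsBoundedUnder (· ≥ ·) atTop t →
      (∀ ε > 0, ∀ᶠ n in atTop, s n ≤ t n + ε) →
      limsup s atTop ≤ limsup t atTop ∧ liminf s atTop ≤ liminf t atTop := by
    intro s t sa sb ta tb hst
    constructor
    · refine le_of_forall_pos_le_add fun ε hε => ?_
      have e := (hm ε).map_limsup_of_continuousAt t
        (by fun_prop) ta (tb.isCoboundedUnder_le)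
      rw [e]
      exact limsup_le_limsup (hst ε hε) sb.isCoboundedUnder_le ((hm ε).isBoundedUnder_le_comp ta)
    · refine le_of_forall_pos_le_add fun ε hε => ?_
      have e := (hm ε).map_liminf_of_continuousAt t
        (by fun_prop) (ta.isCoboundedUnder_ge) tb
      rw [e]
      exact liminf_le_liminf (hst ε hε) sb
        ((hm ε).isBoundedUnder_le_comp ta).isCoboundedUnder_ge
  have k1 := key v w va vb wa wb (fun ε hε => (hd ε hε).mono fun _ h => h.1)
  have k2 := key w v wa wb va vb (fun ε hε => (hd ε hε).mono fun _ h => h.2)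
  exact ⟨le_antisymm k1.1 k2.1, le_antisymm k1.2 k2.2⟩

theorem countUpTo_le (X : Set ℕ) (n : ℕ) : countUpTo X n ≤ n := by
  unfold countUpTo
  calc _ ≤ (Set.Icc 1 n).ncard := Set.ncard_le_ncard Set.inter_subset_right (Set.finite_Icc _ _)
    _ = n := by rw [← Finset.coe_Icc, Set.ncard_coe_finset]; simp

theorem stmt3 (X : Set ℕ) (θ : ℝ) (hθ : 1 ≤ θ) :
    lowerDensity ((fun a : ℕ => (⌊θ * (a : ℝ)⌋).toNat) '' X) = θ⁻¹ * lowerDensity X ∧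
    upperDensity ((fun a : ℕ => (⌊θ * (a : ℝ)⌋).toNat) '' X) = θ⁻¹ * upperDensity X := by
  have hθ0 : 0 < θ := by linarith
  set f : ℕ → ℕ := fun a : ℕ => (⌊θ * (a : ℝ)⌋).toNat with hf
  set Y := f '' X with hY
  have hff : ∀ a, f a = ⌊θ * (a : ℝ)⌋₊ := fun a => by simp [hf, Int.floor_toNat]
  let g : ℕ → ℕ := fun n => ⌈((n : ℝ) + 1) / θ⌉₊ - 1
  have hg1 : ∀ n : ℕ, 0 < ⌈((n : ℝ) + 1) / θ⌉₊ := fun n => Nat.ceil_pos.2 (by positivity)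
  have gc : GaloisConnection f g := by
    intro a n
    have h1 : a ≤ g n ↔ a < ⌈((n : ℝ) + 1) / θ⌉₊ := by
      have := hg1 n
      simp only [g]; omega
    rw [h1, Nat.lt_ceil, lt_div_iff₀ hθ0, hff, ← Nat.lt_succ_iff, Nat.floor_lt (by positivity),
      mul_comm]
    push_cast
    rfl
  have fm : StrictMono f := by
    refine strictMono_nat_of_lt_succ fun a => ?_
    rw [hff, hff, Nat.lt_iff_add_one_le, Nat.le_floor_iff (by positivity)]
    have := Nat.floor_le (a := θ * (a : ℝ)) (by positivity)
    push_cast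
    linarith
  have gf : ∀ a, g (f a) = a := fun a =>
    le_antisymm (fm.le_iff_le.1 (gc.l_u_le _)) (gc.le_u_l a)
  have gt : Tendsto g atTop atTop := by
    refine tendsto_atTop_atTop.2 fun b => ⟨f b, fun n hn => (gc _ _).1 hn⟩
  have gmap : map g atTop = atTop := by
    refine le_antisymm gt ?_
    calc (atTop : Filter ℕ) = map g (map f atTop) := by
          rw [map_map, show g ∘ f = id from funext gf, map_id]
      _ ≤ map g atTop := map_mono fm.tendsto_atTop
  have f0 : ∀ a, 1 ≤ f a ↔ 1 ≤ a := by
    intro a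
    constructor
    · intro h
      by_contra h'
      have : a = 0 := by omega
      subst this
      simp [hf] at h
    · exact fun h => h.trans (fm.le_apply)
  have cnt : ∀ n, countUpTo Y n = countUpTo X (g n) := by
    intro n
    unfold countUpTo
    rw [← Set.ncard_image_of_injective (X ∩ Set.Icc 1 (g n)) fm.injective]
    congr 1
    ext y
    constructor
    · rintro ⟨⟨a, ha, rfl⟩, h1, h2⟩
      exact ⟨a, ⟨ha, (f0 a).1 h1, (gc _ _).1 h2⟩, rfl⟩
    · rintro ⟨a, ⟨ha, h1, h2⟩, rfl⟩
      exact ⟨⟨a, ha, rfl⟩, (f0 a).2 h1, (gc _ _).2 h2⟩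
  let u : ℕ → ℝ := fun n => (countUpTo X n : ℝ) / n
  have u0 : ∀ n, 0 ≤ u n := fun n => by positivity
  have u1 : ∀ n, u n ≤ 1 := fun n =>
    div_le_one_of_le₀ (by exact_mod_cast countUpTo_le X n) (by positivity)
  have ti : θ⁻¹ ≤ 1 := inv_le_one_of_one_le₀ hθ
  have ti0 : 0 < θ⁻¹ := by positivity
  have gb : ∀ n : ℕ, |(g n : ℝ) - n * θ⁻¹| ≤ 1 := by
    intro n
    have e : (g n : ℝ) = (⌈((n : ℝ) + 1) / θ⌉₊ : ℝ) - 1 := by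
      simp only [g]
      rw [Nat.cast_sub (hg1 n)]; simp
    have h1 := Nat.le_ceil (((n : ℝ) + 1) / θ)
    have h2 := Nat.ceil_lt_add_one (a := ((n : ℝ) + 1) / θ) (by positivity)
    have e2 : ((n : ℝ) + 1) / θ = n * θ⁻¹ + θ⁻¹ := by ring
    rw [abs_le, e]
    constructor <;> linarith
  have hlim := limsup_le_aux (fun n : ℕ => (countUpTo Y n : ℝ) / n) (fun n => θ⁻¹ * u (g n))
    (fun n => by positivity)
    (fun n => ⟨mul_nonneg ti0.le (u0 _), mul_le_one₀ ti (u0 _) (u1 _)⟩)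
    (by
      refine squeeze_zero_norm' ?_ tendsto_one_div_atTop_nhds_zero_nat
      filter_upwards [eventually_gt_atTop 0] with n hn
      have hn' : (0 : ℝ) < n := by exact_mod_cast hn
      have e : (countUpTo Y n : ℝ) = u (g n) * g n := by
        rw [cnt]
        rcases Nat.eq_zero_or_pos (g n) with h | h
        · have := countUpTo_le X (g n)
          have h3 : countUpTo X (g n) = 0 := by omega
          simp [h]
          simpa [h] using h3
        · have : (g n : ℝ) ≠ 0 := by positivity
          simp only [u]
          field_simp
      have e2 : (countUpTo Y n : ℝ) / n - θ⁻¹ * u (g n) = u (g n) * (g n - n * θ⁻¹) / n := by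
        rw [e]; field_simp
      rw [e2, Real.norm_eq_abs, abs_div, abs_mul, abs_of_nonneg (u0 _), abs_of_pos hn']
      gcongr
      exact mul_le_one₀ (u1 _) (abs_nonneg _) (gb n))
  have ua : IsBoundedUnder (· ≤ ·) atTop u := isBoundedUnder_of ⟨1, u1⟩
  have ub : IsBoundedUnder (· ≥ ·) atTop u := isBoundedUnder_of ⟨0, u0⟩
  have hm : Monotone (fun x : ℝ => θ⁻¹ * x) := fun a b hab => mul_le_mul_of_nonneg_left hab ti0.le
  have r1 : limsup (fun n => θ⁻¹ * u (g n)) atTop = θ⁻¹ * limsup u atTop := by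
    rw [hm.map_limsup_of_continuousAt u (by fun_prop) ua ub.isCoboundedUnder_le]
    conv_rhs => rw [← gmap]
    rfl
  have r2 : liminf (fun n => θ⁻¹ * u (g n)) atTop = θ⁻¹ * liminf u atTop := by
    rw [hm.map_liminf_of_continuousAt u (by fun_prop) ua.isCoboundedUnder_ge ub]
    conv_rhs => rw [← gmap]
    rfl
  exact ⟨hlim.2.trans r2, hlim.1.trans r1⟩
end

section
/- Let I be a subinterval of [0, 1) and let θ be an irrational real number with θ > 1. Then the set {⌊nθ⌋ : n ∈ ℕ₊, {nθ} ∈ I} has asymptotic density equal to |I|/θ, where |I| is the length of the interval I. -/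
open Filter Pointwise

open Filter Topology

open Classical in
noncomputable def cntS (θ : ℝ) (P : ℝ → Prop) (N : ℕ) : ℝ :=
  ∑ m ∈ Finset.range N, if P (Int.fract (((m + 1 : ℕ) : ℝ) * θ)) then (1 : ℝ) else 0

lemma cntS_mono (θ : ℝ) {P Q : ℝ → Prop} (h : ∀ x, 0 ≤ x → x < 1 → P x → Q x) (N : ℕ) :
    cntS θ P N ≤ cntS θ Q N := by
  classical
  unfold cntS
  refine Finset.sum_le_sum fun m _ => ?_
  have := h _ (Int.fract_nonneg (((m + 1 : ℕ) : ℝ) * θ)) (Int.fract_lt_one _)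
  split_ifs <;> first | (exfalso; tauto) | norm_num

lemma cntS_nonneg (θ : ℝ) (P : ℝ → Prop) (N : ℕ) : 0 ≤ cntS θ P N := by
  classical
  unfold cntS
  refine Finset.sum_nonneg fun m _ => ?_
  split_ifs <;> norm_num

lemma cntS_le (θ : ℝ) (P : ℝ → Prop) (N : ℕ) : cntS θ P N ≤ N := by
  classical
  unfold cntS
  calc _ ≤ ∑ m ∈ Finset.range N, (1 : ℝ) := Finset.sum_le_sum fun m _ => by
        split_ifs <;> norm_num
    _ = N := by simp

lemma fract_sub_id (x y : ℝ) : (if Int.fract x < Int.fract y then (1 : ℝ) else 0) =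
    Int.fract y - Int.fract x + Int.fract (x - y) := by
  have hx0 := Int.fract_nonneg x
  have hx1 := Int.fract_lt_one x
  have hy0 := Int.fract_nonneg y
  have hy1 := Int.fract_lt_one y
  have ex := Int.floor_add_fract x
  have ey := Int.floor_add_fract y
  split_ifs with h
  · have : Int.fract (x - y) = Int.fract x - Int.fract y + 1 := by
      rw [Int.fract_eq_iff]
      refine ⟨by linarith, by linarith, ⌊x⌋ - ⌊y⌋ - 1, ?_⟩
      push_cast
      linarith
    linarith
  · have : Int.fract (x - y) = Int.fract x - Int.fract y := by
      rw [Int.fract_eq_iff]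
      refine ⟨by linarith, by linarith, ⌊x⌋ - ⌊y⌋, ?_⟩
      push_cast
      linarith
    linarith

lemma tele_step (θ : ℝ) (k : ℤ) (N : ℕ) :
    |∑ m ∈ Finset.range N, (Int.fract (((m + 1 : ℕ) : ℝ) * θ - k * θ) -
      Int.fract (((m + 1 : ℕ) : ℝ) * θ - (k + 1 : ℤ) * θ))| ≤ 1 := by
  have := Finset.sum_range_sub (fun m : ℕ => Int.fract ((m : ℝ) * θ - k * θ)) N
  have e : ∑ m ∈ Finset.range N, (Int.fract (((m + 1 : ℕ) : ℝ) * θ - k * θ) -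
      Int.fract (((m + 1 : ℕ) : ℝ) * θ - (k + 1 : ℤ) * θ)) =
      ∑ m ∈ Finset.range N, (Int.fract (((m + 1 : ℕ) : ℝ) * θ - k * θ) -
      Int.fract ((m : ℝ) * θ - k * θ)) := by
    refine Finset.sum_congr rfl fun m _ => ?_
    congr 2
    push_cast
    ring
  rw [e, this, abs_le]
  have h1 := Int.fract_nonneg ((N : ℝ) * θ - k * θ)
  have h2 := Int.fract_lt_one ((N : ℝ) * θ - k * θ)
  have h3 := Int.fract_nonneg (((0 : ℕ) : ℝ) * θ - k * θ)
  have h4 := Int.fract_lt_one (((0 : ℕ) : ℝ) * θ - k * θ)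
  constructor <;> linarith

lemma tele (θ : ℝ) (k : ℤ) : ∃ C : ℝ, ∀ N : ℕ,
    |∑ m ∈ Finset.range N, (Int.fract (((m + 1 : ℕ) : ℝ) * θ) -
      Int.fract (((m + 1 : ℕ) : ℝ) * θ - k * θ))| ≤ C := by
  induction k using Int.induction_on with
  | zero => exact ⟨0, fun N => by simp⟩
  | succ i ih =>
    obtain ⟨C, hC⟩ := ih
    refine ⟨C + 1, fun N => ?_⟩
    have h1 := hC N
    have h2 := tele_step θ i N
    rw [Finset.sum_sub_distrib] at h1 h2 ⊢
    rw [abs_le] at *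
    constructor <;> linarith
  | pred i ih =>
    obtain ⟨C, hC⟩ := ih
    refine ⟨C + 1, fun N => ?_⟩
    have h1 := hC N
    have h2 := tele_step θ (-i - 1) N
    rw [sub_add_cancel] at h2
    rw [Finset.sum_sub_distrib] at h1 h2 ⊢
    rw [abs_le] at *
    constructor <;> linarith

lemma cntS_fract (θ : ℝ) (k : ℤ) :
    Tendsto (fun N : ℕ => cntS θ (fun x => x < Int.fract (k * θ)) N / N) atTop
      (𝓝 (Int.fract (k * θ))) := by
  classical
  obtain ⟨C, hC⟩ := tele θ k
  have key : ∀ N : ℕ, |cntS θ (fun x => x < Int.fract (k * θ)) N - N * Int.fract (k * θ)| ≤ C := by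
    intro N
    have h := hC N
    have e : cntS θ (fun x => x < Int.fract (k * θ)) N = N * Int.fract (k * θ) -
      ∑ m ∈ Finset.range N, (Int.fract (((m + 1 : ℕ) : ℝ) * θ) -
      Int.fract (((m + 1 : ℕ) : ℝ) * θ - k * θ)) := by
      unfold cntS
      rw [show (N : ℝ) * Int.fract (k * θ) = ∑ m ∈ Finset.range N, Int.fract (k * θ) by simp,
        ← Finset.sum_sub_distrib]
      refine Finset.sum_congr rfl fun m _ => ?_
      have := fract_sub_id (((m + 1 : ℕ) : ℝ) * θ) (k * θ)
      rw [sub_sub_eq_add_sub, add_sub_right_comm]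
      convert this using 2
    rw [e]
    rw [abs_le] at *
    constructor <;> linarith
  rw [tendsto_iff_dist_tendsto_zero]
  refine squeeze_zero' (g := fun N : ℕ => C / N) (Eventually.of_forall fun _ => dist_nonneg) ?_
    (tendsto_const_div_atTop_nhds_zero_nat C)
  filter_upwards [eventually_gt_atTop 0] with N hN
  have hN' : (0 : ℝ) < N := by exact_mod_cast hN
  rw [Real.dist_eq, show cntS θ (fun x => x < Int.fract (k * θ)) N / N - Int.fract (k * θ) =
    (cntS θ (fun x => x < Int.fract (k * θ)) N - N * Int.fract (k * θ)) / N by field_simp,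
    abs_div, abs_of_pos hN']
  gcongr
  exact key N

lemma exists_fract {θ : ℝ} (hirr : Irrational θ) {u v : ℝ} (hu : 0 ≤ u) (huv : u < v)
    (hv : v ≤ 1) : ∃ k : ℤ, u < Int.fract (k * θ) ∧ Int.fract (k * θ) < v := by
  have hd : Dense (AddSubgroup.closure {θ, 1} : Set ℝ) :=
    dense_addSubgroupClosure_pair_iff.2 (by simpa using hirr)
  obtain ⟨y, hy, hyu, hyv⟩ := hd.exists_between huv
  obtain ⟨m, n, hmn⟩ := AddSubgroup.mem_closure_pair.1 hy
  refine ⟨m, ?_⟩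
  have : Int.fract (m * θ) = y := by
    rw [Int.fract_eq_iff]
    refine ⟨by linarith, by linarith, -n, ?_⟩
    simp only [zsmul_eq_mul, mul_one] at hmn
    push_cast
    linarith
  rw [this]
  exact ⟨hyu, hyv⟩

lemma cntS_tendsto {θ : ℝ} (hirr : Irrational θ) {c : ℝ} (h0 : 0 ≤ c) (h1 : c ≤ 1)
    {P : ℝ → Prop} (hP : ∀ x, x < c → P x) (hP' : ∀ x, P x → x ≤ c) :
    Tendsto (fun N : ℕ => cntS θ P N / N) atTop (𝓝 c) := by
  rw [tendsto_order]
  constructor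
  · intro a ha
    rcases h0.eq_or_lt with rfl | h0
    · exact Eventually.of_forall fun N =>
        ha.trans_le (div_nonneg (cntS_nonneg _ _ _) (Nat.cast_nonneg _))
    · obtain ⟨k, hk1, hk2⟩ := exists_fract hirr (le_max_right a 0) (max_lt ha h0) h1
      filter_upwards [(cntS_fract θ k).eventually_const_lt ((le_max_left a 0).trans_lt hk1)] with N hN
      refine hN.trans_le ?_
      gcongr
      exact cntS_mono θ (fun x _ _ hx => hP x (hx.trans hk2)) N
  · intro a ha
    rcases h1.eq_or_lt with rfl | h1
    · exact Eventually.of_forall fun N =>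
        (div_le_one_of_le₀ (cntS_le _ _ _) (Nat.cast_nonneg _)).trans_lt ha
    · obtain ⟨k, hk1, hk2⟩ := exists_fract hirr h0 (lt_min ha h1) (min_le_right a 1)
      filter_upwards [(cntS_fract θ k).eventually_lt_const (hk2.trans_le (min_le_left a 1))] with N hN
      refine lt_of_le_of_lt ?_ hN
      gcongr
      exact cntS_mono θ (fun x _ _ hx => (hP' x hx).trans_lt hk1) N

lemma cntS_add_le (θ : ℝ) {P Q R : ℝ → Prop} (h : ∀ x, P x → R x) (h' : ∀ x, Q x → R x)
    (hd : ∀ x, P x → ¬ Q x) (N : ℕ) : cntS θ P N + cntS θ Q N ≤ cntS θ R N := by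
  classical
  unfold cntS
  rw [← Finset.sum_add_distrib]
  refine Finset.sum_le_sum fun m _ => ?_
  have h1 := h (Int.fract (((m + 1 : ℕ) : ℝ) * θ))
  have h2 := h' (Int.fract (((m + 1 : ℕ) : ℝ) * θ))
  have h3 := hd (Int.fract (((m + 1 : ℕ) : ℝ) * θ))
  split_ifs <;> first | (exfalso; tauto) | norm_num

lemma cntS_le_add (θ : ℝ) {P Q R : ℝ → Prop} (h : ∀ x, R x → P x ∨ Q x)
    (N : ℕ) : cntS θ R N ≤ cntS θ P N + cntS θ Q N := by
  classical
  unfold cntS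
  rw [← Finset.sum_add_distrib]
  refine Finset.sum_le_sum fun m _ => ?_
  have h1 := h (Int.fract (((m + 1 : ℕ) : ℝ) * θ))
  split_ifs <;> first | (exfalso; tauto) | norm_num

lemma cntS_interval {θ : ℝ} (hirr : Irrational θ) (I : Set ℝ) (hI : I ⊆ Set.Ico 0 1)
    (hI' : I.OrdConnected) :
    Tendsto (fun N : ℕ => cntS θ (· ∈ I) N / N) atTop (𝓝 (MeasureTheory.volume I).toReal) := by
  rcases I.eq_empty_or_nonempty with rfl | hne
  · simp [cntS]
  have hbb : BddBelow I := ⟨0, fun x hx => (hI hx).1⟩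
  have hba : BddAbove I := ⟨1, fun x hx => (hI hx).2.le⟩
  set a := sInf I with ha
  set b := sSup I with hb
  have ha0 : 0 ≤ a := le_csInf hne fun x hx => (hI hx).1
  have hb1 : b ≤ 1 := csSup_le hne fun x hx => (hI hx).2.le
  have hab : a ≤ b := csInf_le_csSup hne hbb hba
  have hsub : I ⊆ Set.Icc a b := fun x hx => ⟨csInf_le hbb hx, le_csSup hba hx⟩
  have hsup : Set.Ioo a b ⊆ I := by
    intro x hx
    obtain ⟨y, hy, hyx⟩ := exists_lt_of_csInf_lt hne hx.1
    obtain ⟨z, hz, hzx⟩ := exists_lt_of_lt_csSup hne hx.2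
    exact hI'.out hy hz ⟨hyx.le, hzx.le⟩
  have hvol : (MeasureTheory.volume I).toReal = b - a := by
    have : MeasureTheory.volume I = ENNReal.ofReal (b - a) := by
      apply le_antisymm
      · simpa using MeasureTheory.measure_mono (μ := MeasureTheory.volume) hsub
      · simpa using MeasureTheory.measure_mono (μ := MeasureTheory.volume) hsup
    rw [this, ENNReal.toReal_ofReal (by linarith)]
  rw [hvol]
  have hb0 := ha0.trans hab
  have ha1 := hab.trans hb1
  have A1 := cntS_tendsto hirr ha0 ha1 (P := fun x => x < a) (fun x h => h) (fun x h => h.le)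
  have A2 := cntS_tendsto hirr ha0 ha1 (P := fun x => x ≤ a) (fun x h => h.le) (fun x h => h)
  have B1 := cntS_tendsto hirr hb0 hb1 (P := fun x => x < b) (fun x h => h) (fun x h => h.le)
  have B2 := cntS_tendsto hirr hb0 hb1 (P := fun x => x ≤ b) (fun x h => h.le) (fun x h => h)
  refine tendsto_of_tendsto_of_tendsto_of_le_of_le (B1.sub A2) (B2.sub A1) ?_ ?_
  · intro N
    have := cntS_le_add θ (P := (· ∈ I)) (Q := fun x => x ≤ a) (R := fun x => x < b)
      (fun x hx => (le_or_gt x a).symm.imp_left fun h => hsup ⟨h, hx⟩) N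
    simp only
    rw [← sub_div]
    gcongr
    linarith
  · intro N
    have := cntS_add_le θ (P := (· ∈ I)) (Q := fun x => x < a) (R := fun x => x ≤ b)
      (fun x hx => (hsub hx).2) (fun x hx => hx.le.trans hab)
      (fun x hx => not_lt.2 (hsub hx).1) N
    simp only
    rw [← sub_div]
    gcongr
    linarith

lemma count_eq {θ : ℝ} (hirr : Irrational θ) (hθ : 1 < θ) (I : Set ℝ) (n : ℕ) :
    (countUpTo ((fun n : ℕ => (⌊(n : ℝ) * θ⌋).toNat) ''
        {n : ℕ | 0 < n ∧ Int.fract ((n : ℝ) * θ) ∈ I}) n : ℝ) =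
      cntS θ (· ∈ I) ⌊((n + 1 : ℕ) : ℝ) / θ⌋₊ := by
  classical
  have hpos : 0 < θ := by linarith
  set M := ⌊((n + 1 : ℕ) : ℝ) / θ⌋₊ with hM
  set f : ℕ → ℕ := fun m => (⌊((m + 1 : ℕ) : ℝ) * θ⌋).toNat with hf
  have hfl : ∀ m : ℕ, f m = ⌊((m + 1 : ℕ) : ℝ) * θ⌋₊ := fun m => rfl
  have hmono : StrictMono f := by
    refine strictMono_nat_of_lt_succ fun m => ?_
    rw [hfl, hfl, ← Nat.add_one_le_iff]
    apply Nat.le_floor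
    have := Nat.floor_le (a := ((m + 1 : ℕ) : ℝ) * θ) (by positivity)
    push_cast at *
    linarith
  have hset : ((fun n : ℕ => (⌊(n : ℝ) * θ⌋).toNat) ''
        {n : ℕ | 0 < n ∧ Int.fract ((n : ℝ) * θ) ∈ I}) ∩ Set.Icc 1 n =
      (((Finset.range M).filter
        (fun m => Int.fract (((m + 1 : ℕ) : ℝ) * θ) ∈ I)).image f : Finset ℕ) := by
    have hlt : ∀ m : ℕ, f m ≤ n ↔ m < M := by
      intro m
      rw [hfl, ← Nat.lt_add_one_iff, Nat.floor_lt (by positivity), ← Nat.add_one_le_iff, hM,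
        Nat.le_floor_iff (by positivity), le_div_iff₀ hpos, le_iff_lt_or_eq]
      constructor
      · exact Or.inl
      · rintro (h | h)
        · exact h
        · exact absurd h ((hirr.natCast_mul (Nat.succ_ne_zero m)).ne_nat _)
    have hge : ∀ m : ℕ, 1 ≤ f m := by
      intro m
      rw [hfl]
      apply Nat.le_floor
      push_cast
      nlinarith [(Nat.cast_nonneg m : (0 : ℝ) ≤ m)]
    ext x
    simp only [Set.mem_inter_iff, Set.mem_image, Set.mem_ofPred_eq, Set.mem_Icc, Finset.coe_image,
      Finset.coe_filter, Finset.mem_range]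
    constructor
    · rintro ⟨⟨m, ⟨hm, hmI⟩, rfl⟩, -, h2⟩
      obtain ⟨m, rfl⟩ := Nat.exists_eq_succ_of_ne_zero hm.ne'
      exact ⟨m, ⟨(hlt m).1 h2, hmI⟩, rfl⟩
    · rintro ⟨m, ⟨hm, hmI⟩, rfl⟩
      exact ⟨⟨m + 1, ⟨Nat.succ_pos m, hmI⟩, rfl⟩, hge m, (hlt m).2 hm⟩
  unfold countUpTo
  rw [hset, Set.ncard_coe_finset, Finset.card_image_of_injective _ hmono.injective]
  unfold cntS
  rw [Finset.sum_boole]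
theorem stmt4 (I : Set ℝ) (hI : I ⊆ Set.Ico 0 1) (hI' : I.OrdConnected)
    (θ : ℝ) (hirr : Irrational θ) (hθ : 1 < θ) :
    HasDensity
      ((fun n : ℕ => (⌊(n : ℝ) * θ⌋).toNat) ''
        {n : ℕ | 0 < n ∧ Int.fract ((n : ℝ) * θ) ∈ I})
      ((MeasureTheory.volume I).toReal / θ) := by
  have hpos : 0 < θ := by linarith
  unfold HasDensity
  simp_rw [count_eq hirr hθ]
  have hu : Tendsto (fun n : ℕ => ((n + 1 : ℕ) : ℝ) / θ) atTop atTop :=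
    ((tendsto_natCast_atTop_atTop (R := ℝ)).comp (tendsto_add_atTop_nat 1)).atTop_div_const hpos
  have h1 := (cntS_interval hirr I hI hI').comp (tendsto_nat_floor_atTop.comp hu)
  have h2 : Tendsto (fun n : ℕ => (⌊((n + 1 : ℕ) : ℝ) / θ⌋₊ : ℝ) / (((n + 1 : ℕ) : ℝ) / θ))
    atTop (𝓝 1) := tendsto_nat_floor_div_atTop.comp hu
  have h3 : Tendsto (fun n : ℕ => ((n + 1 : ℕ) : ℝ) / n / θ) atTop (𝓝 (1 / θ)) := by
    refine Tendsto.div_const ?_ θ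
    have : Tendsto (fun n : ℕ => 1 + 1 / (n : ℝ)) atTop (𝓝 (1 + 0)) :=
      tendsto_const_nhds.add (tendsto_const_div_atTop_nhds_zero_nat 1)
    rw [add_zero] at this
    refine this.congr' ?_
    filter_upwards [eventually_gt_atTop 0] with n hn
    have : (n : ℝ) ≠ 0 := by exact_mod_cast hn.ne'
    push_cast
    field_simp
  have h4 := (h1.mul h2).mul h3
  rw [mul_one, mul_one_div] at h4
  refine h4.congr' ?_
  have hfl := (tendsto_nat_floor_atTop.comp hu).eventually_gt_atTop 0
  filter_upwards [eventually_gt_atTop 0, hfl] with n hn hM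
  simp only [Function.comp] at hM ⊢
  have e1 : (n : ℝ) ≠ 0 := by exact_mod_cast hn.ne'
  have e2 : (⌊((n + 1 : ℕ) : ℝ) / θ⌋₊ : ℝ) ≠ 0 := by exact_mod_cast hM.ne'
  have e3 : ((n + 1 : ℕ) : ℝ) ≠ 0 := by exact_mod_cast Nat.succ_ne_zero n
  generalize cntS θ (· ∈ I) ⌊((n + 1 : ℕ) : ℝ) / θ⌋₊ = c
  generalize (⌊((n + 1 : ℕ) : ℝ) / θ⌋₊ : ℝ) = d at e2 ⊢
  generalize ((n + 1 : ℕ) : ℝ) = r at e3 ⊢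
  field_simp
end

section
/- Let m, n, k be integers with 3 ≤ m ≤ n − 1 and k ≥ 2. Let H := {0, 1, …, m−2} ∪ {m} and let A := ⋃_{h ∈ H} (nk·ℕ + h) = {nkt + h : t ∈ ℕ, h ∈ H}. Then for every integer j with 1 ≤ j ≤ k, the asymptotic density of the j-fold sumset jA exists and equals jm/(nk). -/
open Filter Pointwise

lemma foldSum_succ_mem (j : ℕ) (A : Set ℕ) (x : ℕ) :
    x ∈ foldSum (j+1) A ↔ ∃ a ∈ A, ∃ y ∈ foldSum j A, x = a + y := by
  constructor
  · rintro ⟨f, hf, rfl⟩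
    exact ⟨f 0, hf 0, ∑ i : Fin j, f i.succ, ⟨fun i => f i.succ, fun i => hf _, rfl⟩,
      Fin.sum_univ_succ f⟩
  · rintro ⟨a, ha, y, ⟨f, hf, rfl⟩, rfl⟩
    refine ⟨Fin.cons a f, ?_, ?_⟩
    · intro i
      refine Fin.cases ?_ ?_ i
      · simpa using ha
      · intro i; simpa using hf i
    · simp [Fin.sum_univ_succ]

lemma foldSum_char (m N : ℕ) (hm : 3 ≤ m) (j : ℕ) (hj : 1 ≤ j) (x : ℕ) :
    x ∈ foldSum j {x : ℕ | ∃ t : ℕ, ∃ h ∈ ({h : ℕ | h ≤ m - 2} ∪ {m} : Set ℕ),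
          x = N * t + h} ↔ ∃ t h : ℕ, h ≤ j * m ∧ h ≠ j * m - 1 ∧ x = N * t + h := by
  induction j, hj using Nat.le_induction generalizing x with
  | base =>
    constructor
    · rintro ⟨f, hf, rfl⟩
      obtain ⟨t, h, hh, e⟩ := hf 0
      simp only [Set.mem_union, Set.mem_ofPred_eq, Set.mem_singleton_iff] at hh
      exact ⟨t, h, by omega, by omega, by simpa using e⟩
    · rintro ⟨t, h, h1, h2, rfl⟩
      refine ⟨fun _ => N * t + h, fun _ => ⟨t, h, ?_, rfl⟩, by simp⟩
      simp only [Set.mem_union, Set.mem_ofPred_eq, Set.mem_singleton_iff]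
      omega
  | succ j hj ih =>
    rw [foldSum_succ_mem]
    have hd : 3 ≤ j * m := by nlinarith
    rw [Nat.succ_mul]
    constructor
    · rintro ⟨a, ⟨t, h, hh, rfl⟩, y, hy, rfl⟩
      obtain ⟨s, g, h1, h2, rfl⟩ := (ih y).1 hy
      simp only [Set.mem_union, Set.mem_ofPred_eq, Set.mem_singleton_iff] at hh
      exact ⟨t + s, h + g, by omega, by omega, by ring⟩
    · rintro ⟨t, h, h1, h2, rfl⟩
      have key : ∃ a b, (a ≤ m - 2 ∨ a = m) ∧ b ≤ j * m ∧ b ≠ j * m - 1 ∧ h = a + b := by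
        by_cases c1 : h = j * m - 1
        · exact ⟨1, j * m - 2, by omega, by omega, by omega, by omega⟩
        by_cases c2 : h ≤ j * m
        · exact ⟨0, h, by omega, by omega, by omega, by omega⟩
        · exact ⟨h - j * m, j * m, by omega, by omega, by omega, by omega⟩
      obtain ⟨a, b, ha, hb, hb', rfl⟩ := key
      exact ⟨N * t + a, ⟨t, a, ha, rfl⟩, b, (ih b).2 ⟨0, b, hb, hb', by simp⟩, by ring⟩

lemma countUpTo_eq (p : ℕ → Prop) [DecidablePred p] (n : ℕ) :
    countUpTo {x | p x} n = ((Finset.Icc 1 n).filter p).card := by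
  unfold countUpTo
  rw [← Set.ncard_coe_finset]
  congr 1
  ext x
  simp [and_comm]

lemma density_periodic (p : ℕ → Prop) [DecidablePred p] (N : ℕ) (hN : 0 < N)
    (hp : Function.Periodic p N) :
    HasDensity {x | p x} ((N.count p : ℝ) / N) := by
  have hN' : (0:ℝ) < N := by exact_mod_cast hN
  have hcN : N.count p ≤ N := Nat.count_le p
  have step : ∀ n, countUpTo {x | p x} (n + N) = countUpTo {x | p x} n + N.count p := by
    intro n
    rw [countUpTo_eq, countUpTo_eq, ← Nat.filter_Ico_card_eq_of_periodic (n+1) N p hp,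
      ← Finset.card_union_of_disjoint, ← Finset.filter_union]
    · congr 2
      ext x
      simp only [Finset.mem_union, Finset.mem_Icc, Finset.mem_Ico]
      omega
    · apply Finset.disjoint_filter_filter
      rw [Finset.disjoint_left]
      intro x
      simp only [Finset.mem_Icc, Finset.mem_Ico]
      omega
  have bd : ∀ n : ℕ, |(countUpTo {x | p x} n : ℝ) - (N.count p : ℝ) / N * n| ≤ N := by
    intro n
    induction n using Nat.strong_induction_on with
    | _ n ih =>
      by_cases h : n < N
      · have h1 : countUpTo {x | p x} n ≤ n := by
          rw [countUpTo_eq]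
          exact (Finset.card_filter_le _ _).trans (by simp)
        have h1' : (countUpTo {x | p x} n : ℝ) ≤ N := by exact_mod_cast h1.trans h.le
        have h2 : (N.count p : ℝ) / N * n ≤ 1 * N := by
          apply mul_le_mul
          · rw [div_le_one hN']; exact_mod_cast hcN
          · exact_mod_cast h.le
          · positivity
          · norm_num
        have h3 : 0 ≤ (N.count p : ℝ) / N * n := by positivity
        have h4 : (0:ℝ) ≤ (countUpTo {x | p x} n : ℝ) := by positivity
        rw [abs_le]; constructor <;> linarith
      · obtain ⟨r, rfl⟩ : ∃ r, n = r + N := ⟨n - N, by omega⟩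
        have := ih r (by omega)
        rw [step]
        push_cast
        convert this using 2
        field_simp
        ring
  unfold HasDensity
  rw [tendsto_iff_norm_sub_tendsto_zero]
  refine squeeze_zero' (Eventually.of_forall fun _ => norm_nonneg _) ?_
    (tendsto_const_div_atTop_nhds_zero_nat (N : ℝ))
  filter_upwards [eventually_gt_atTop 0] with n hn
  have hn' : (0:ℝ) < n := by exact_mod_cast hn
  rw [Real.norm_eq_abs, le_div_iff₀ hn']
  calc _ = |((countUpTo {x | p x} n : ℝ) / n - (N.count p : ℝ) / N) * n| := by
        rw [abs_mul, abs_of_pos hn']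
    _ ≤ N := by
        convert bd n using 2
        field_simp

theorem stmt7 (m n k : ℕ) (hm : 3 ≤ m) (hmn : m ≤ n - 1) (hk : 2 ≤ k) :
    ∀ j : ℕ, 1 ≤ j → j ≤ k →
      HasDensity
        (foldSum j {x : ℕ | ∃ t : ℕ, ∃ h ∈ ({h : ℕ | h ≤ m - 2} ∪ {m} : Set ℕ),
          x = n * k * t + h})
        ((j : ℝ) * m / (n * k)) := by
  intro j hj hjk
  have hlt : j * m < n * k := by
    have : m < n := by omega
    calc j * m ≤ k * m := Nat.mul_le_mul_right _ hjk
      _ < k * n := Nat.mul_lt_mul_of_pos_left this (by omega)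
      _ = n * k := Nat.mul_comm _ _
  have hd : 3 ≤ j * m := by nlinarith
  have hset : (foldSum j {x : ℕ | ∃ t : ℕ, ∃ h ∈ ({h : ℕ | h ≤ m - 2} ∪ {m} : Set ℕ),
          x = n * k * t + h}) =
      {x | x % (n * k) ≤ j * m ∧ x % (n * k) ≠ j * m - 1} := by
    ext x
    rw [foldSum_char m (n * k) hm j hj]
    constructor
    · rintro ⟨t, h, h1, h2, rfl⟩
      have : (n * k * t + h) % (n * k) = h := by
        rw [Nat.mul_add_mod, Nat.mod_eq_of_lt (by omega)]
      simp only [Set.mem_ofPred_eq, this]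
      exact ⟨h1, h2⟩
    · rintro ⟨h1, h2⟩
      exact ⟨x / (n * k), x % (n * k), h1, h2, (Nat.div_add_mod _ _).symm⟩
  rw [hset]
  have hcount : (n * k).count (fun x => x % (n * k) ≤ j * m ∧ x % (n * k) ≠ j * m - 1)
      = j * m := by
    rw [Nat.count_eq_card_filter_range]
    have : (Finset.range (n * k)).filter
        (fun x => x % (n * k) ≤ j * m ∧ x % (n * k) ≠ j * m - 1)
        = (Finset.range (j * m + 1)).erase (j * m - 1) := by
      ext x
      simp only [Finset.mem_filter, Finset.mem_range, Finset.mem_erase]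
      constructor
      · rintro ⟨h, h1⟩
        rw [Nat.mod_eq_of_lt h] at h1
        omega
      · rintro ⟨h1, h2⟩
        have h : x < n * k := by omega
        rw [Nat.mod_eq_of_lt h]
        omega
    rw [this, Finset.card_erase_of_mem (by simp only [Finset.mem_range]; omega)]
    simp
  have := density_periodic (fun x => x % (n * k) ≤ j * m ∧ x % (n * k) ≠ j * m - 1)
    (n * k) (by omega) (by intro x; simp)
  rw [hcount] at this
  push_cast at this
  exact this
end

section
/- Let m, n, k be integers with 3 ≤ m ≤ n − 1 and k ≥ 2. Let H := {0, 1, …, m−2} ∪ {m} and let A := ⋃_{h ∈ H} (nk·ℕ + h). Then for every integer j with 1 ≤ j ≤ k, the j-fold sumset satisfies jA = nk·ℕ + jH, i.e., jA = {nkt + s : t ∈ ℕ, s ∈ jH}, where jH denotes the j-fold sumset of H. -/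
open Filter Pointwise

theorem stmt8 (m n k : ℕ) (hm : 3 ≤ m) (hmn : m ≤ n - 1) (hk : 2 ≤ k) :
    ∀ j : ℕ, 1 ≤ j → j ≤ k →
      foldSum j {x : ℕ | ∃ t : ℕ, ∃ h ∈ ({h : ℕ | h ≤ m - 2} ∪ {m} : Set ℕ),
          x = n * k * t + h}
        = {x : ℕ | ∃ t : ℕ, ∃ s ∈ foldSum j ({h : ℕ | h ≤ m - 2} ∪ {m} : Set ℕ),
            x = n * k * t + s} := by
  intro j hj _
  ext x
  constructor
  · rintro ⟨f, hf, rfl⟩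
    choose t h hh e using hf
    refine ⟨∑ i, t i, ∑ i, h i, ⟨h, hh, rfl⟩, ?_⟩
    rw [Finset.mul_sum, ← Finset.sum_add_distrib]
    exact Finset.sum_congr rfl fun i _ => e i
  · rintro ⟨t, s, ⟨h, hh, rfl⟩, rfl⟩
    refine ⟨fun i => n * k * (if i = ⟨0, hj⟩ then t else 0) + h i,
      fun i => ⟨_, h i, hh i, rfl⟩, ?_⟩
    rw [Finset.sum_add_distrib, ← Finset.mul_sum]
    simp
end

section
/- Let α be an irrational real number with 0 < α < 1, let θ := 1/α, let k ≥ 2 be an integer, and define A := {⌊nθ⌋ : n ∈ ℕ₊, {nθ} < 1/k}. Then for every integer j with 2 ≤ j ≤ k, the j-fold sumset jA is contained in T_j := {⌊mθ⌋ : m ∈ ℕ₊, {mθ} < j/k}; consequently, the upper asymptotic density of jA is at most jα/k. -/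
open Filter Pointwise

lemma aux_den (x : ℝ) (hx : Irrational x) (D : ℕ) :
    ∃ r : ℚ, D < r.den ∧ |x - r| * r.den * r.den ≤ 1 := by
  have h := hx.eventually_forall_le_dist_cast_rat_of_den_le D
  have h2 : ∀ᶠ n : ℕ in atTop, ∀ r : ℚ, r.den ≤ D → (1 / ((n : ℝ) + 1)) * 2 ≤ dist x r := by
    have ht : Tendsto (fun n : ℕ => (1 / ((n : ℝ) + 1)) * 2) atTop (nhds 0) := by
      simpa using (tendsto_one_div_add_atTop_nhds_zero_nat (𝕜 := ℝ)).mul_const 2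
    exact ht.eventually h
  obtain ⟨n, hn, hn0⟩ := (h2.and (eventually_gt_atTop 0)).exists
  obtain ⟨r, hr, hrd⟩ := Real.exists_rat_abs_sub_le_and_den_le x hn0
  have hd : (1 : ℝ) ≤ r.den := by exact_mod_cast r.den_pos
  have hrn : (r.den : ℝ) ≤ n := by exact_mod_cast hrd
  have hn1 : (0 : ℝ) < (n : ℝ) + 1 := by positivity
  have e : (1 : ℝ) / ((n + 1) * r.den) * r.den = 1 / (n + 1) := by
    field_simp
  have h3 : |x - r| * r.den ≤ 1 / (n + 1) := by
    rw [← e]; gcongr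
  have h4 : |x - r| * r.den * r.den ≤ 1 / (n + 1) * r.den := by gcongr
  refine ⟨r, ?_, ?_⟩
  · by_contra hc
    have := hn r (not_lt.mp hc)
    rw [Real.dist_eq] at this
    have hp : 0 < 1 / ((n : ℝ) + 1) := by positivity
    nlinarith [abs_nonneg (x - r)]
  · refine h4.trans ?_
    rw [one_div, inv_mul_le_iff₀ hn1]; linarith

open Classical in
lemma aux_block (x c : ℝ) (hc : 0 < c) (r : ℚ) (hr : |x - r| * r.den * r.den ≤ 1) (m0 : ℕ) :
    (((Finset.range r.den).filter
      (fun i : ℕ => Int.fract (((m0 + i : ℕ) : ℝ) * x) < c)).card : ℝ) ≤ r.den * c + 3 := by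
  set q := r.den with hq
  have hqpos : (0 : ℝ) < q := by exact_mod_cast r.den_pos
  set S := (Finset.range q).filter (fun i : ℕ => Int.fract (((m0 + i : ℕ) : ℝ) * x) < c) with hS
  let z : ℕ → ℤ := fun i => i * r.num - q * ⌊((m0 + i : ℕ) : ℝ) * x⌋
  set a : ℝ := -(q * m0 * x) - 1 with ha
  set b : ℝ := q * c - q * m0 * x + 1 with hb
  have hmaps : ∀ i ∈ S, z i ∈ Finset.Icc ⌈a⌉ ⌊b⌋ := by
    intro i hi
    rw [hS, Finset.mem_filter, Finset.mem_range] at hi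
    obtain ⟨hiq, hif⟩ := hi
    have hiq' : (i : ℝ) ≤ q := by exact_mod_cast hiq.le
    have hnum : (r.num : ℝ) = r * q := by
      have := Rat.mul_den_eq_num r
      rw [hq]; exact_mod_cast this.symm
    have hfr := Int.self_sub_floor (((m0 + i : ℕ) : ℝ) * x)
    have hf0 := Int.fract_nonneg (((m0 + i : ℕ) : ℝ) * x)
    have hz : ((z i : ℤ) : ℝ) = q * Int.fract (((m0 + i : ℕ) : ℝ) * x) - q * m0 * x
        - i * ((x - r) * q) := by
      rw [← hfr]
      simp only [z]
      push_cast
      rw [hnum]; ring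
    have hA : |(i : ℝ) * ((x - r) * q)| ≤ 1 := by
      rw [abs_mul, abs_mul, abs_of_nonneg hqpos.le, Nat.abs_cast]
      calc (i : ℝ) * (|x - r| * q) ≤ q * (|x - r| * q) := by gcongr
        _ ≤ 1 := by linarith
    have hA' := abs_le.mp hA
    have h1 : 0 ≤ (q : ℝ) * Int.fract (((m0 + i : ℕ) : ℝ) * x) := by positivity
    have h2 : (q : ℝ) * Int.fract (((m0 + i : ℕ) : ℝ) * x) ≤ q * c := by gcongr
    rw [Finset.mem_Icc, Int.ceil_le, Int.le_floor, hz]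
    constructor <;> linarith [hA'.1, hA'.2]
  have hinj : Set.InjOn z S := by
    intro i hi i' hi' h
    have hi := (Finset.mem_range.mp (Finset.mem_filter.mp hi).1)
    have hi' := (Finset.mem_range.mp (Finset.mem_filter.mp hi').1)
    simp only [z] at h
    have hd : (q : ℤ) ∣ ((i : ℤ) - i') * r.num := 
      ⟨⌊((m0 + i : ℕ) : ℝ) * x⌋ - ⌊((m0 + i' : ℕ) : ℝ) * x⌋, by linarith⟩
    have hcop : IsCoprime (q : ℤ) r.num := by
      rw [Int.isCoprime_iff_gcd_eq_one, Int.gcd_comm]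
      have := r.reduced
      simpa [Int.gcd, Nat.Coprime] using this
    have hd2 := hcop.dvd_of_dvd_mul_right hd
    have := Int.eq_zero_of_abs_lt_dvd hd2 (by rw [abs_lt]; constructor <;> omega)
    omega
  have hcard := Finset.card_le_card_of_injOn z hmaps hinj
  rw [Int.card_Icc] at hcard
  have hab : 0 ≤ b - a := by
    have : 0 < q * c := by positivity
    rw [ha, hb]; linarith
  have h5 : ((⌊b⌋ + 1 - ⌈a⌉).toNat : ℝ) ≤ b - a + 1 := by
    have h6 : ((⌊b⌋ + 1 - ⌈a⌉).toNat : ℝ) = ((max (⌊b⌋ + 1 - ⌈a⌉) 0 : ℤ) : ℝ) := by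
      rw [← Int.toNat_eq_max]; exact (Int.cast_natCast _).symm
    rw [h6]; push_cast
    apply max_le
    · linarith [Int.floor_le b, Int.le_ceil a]
    · linarith
  have h7 : (S.card : ℝ) ≤ ((⌊b⌋ + 1 - ⌈a⌉).toNat : ℝ) := by exact_mod_cast hcard
  rw [ha, hb] at h5
  linarith

open Classical in
lemma aux_blocks (x c : ℝ) (hc : 0 < c) (r : ℚ) (hr : |x - r| * r.den * r.den ≤ 1) (B : ℕ) :
    (((Finset.range (B * r.den)).filter
      (fun i : ℕ => Int.fract ((i : ℝ) * x) < c)).card : ℝ) ≤ B * (r.den * c + 3) := by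
  induction B with
  | zero => simp
  | succ B ih =>
    have h := aux_block x c hc r hr (B * r.den)
    rw [Finset.card_filter] at ih h ⊢
    rw [Nat.succ_mul, Finset.sum_range_add]
    push_cast at ih h ⊢
    linarith

lemma aux_count_s11 (α θ c : ℝ) (hirr : Irrational α) (h0 : 0 < α)
    (hθ : θ = 1 / α) (hc : 0 < c) (X : Set ℕ)
    (hX : X ⊆ (fun m : ℕ => (⌊(m : ℝ) * θ⌋).toNat) ''
          {m : ℕ | 0 < m ∧ Int.fract ((m : ℝ) * θ) < c}) :
    upperDensity X ≤ α * c := by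
  classical
  have hθirr : Irrational θ := by rw [hθ, one_div]; exact hirr.inv
  apply le_of_forall_pos_le_add
  intro ε hε
  obtain ⟨D, hD⟩ := exists_nat_gt (6 * α / ε)
  obtain ⟨r, hDr, hr⟩ := aux_den θ hθirr D
  have hq : (0 : ℝ) < r.den := by exact_mod_cast r.den_pos
  have hDq : (D : ℝ) < r.den := by exact_mod_cast hDr
  set q : ℝ := (Nat.cast r.den : ℝ) with hqdef
  have hsmall : 3 * α / q ≤ ε / 2 := by
    rw [div_le_iff₀ hq]
    rw [div_lt_iff₀ hε] at hD
    nlinarith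
  have key : ∀ n : ℕ, (countUpTo X n : ℝ) ≤ (((n : ℝ) + 1) * α / q + 1) * (q * c + 3) := by
    intro n
    set M : ℕ := ⌊((n : ℝ) + 1) * α⌋₊ with hM
    set F := (Finset.range ((M / r.den + 1) * r.den)).filter
      (fun i : ℕ => Int.fract ((i : ℝ) * θ) < c) with hF
    have hsub : X ∩ Set.Icc 1 n ⊆
        ((F.image (fun m : ℕ => (⌊(m : ℝ) * θ⌋).toNat) : Finset ℕ) : Set ℕ) := by
      rintro y ⟨hy, hy1, hyn⟩
      obtain ⟨m, ⟨hm0, hmf⟩, rfl⟩ := hX hy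
      rw [Finset.coe_image]
      refine ⟨m, ?_, rfl⟩
      rw [Finset.mem_coe, hF, Finset.mem_filter, Finset.mem_range]
      refine ⟨?_, hmf⟩
      have hfl : ⌊(m : ℝ) * θ⌋ ≤ n := by
        have : (⌊(m : ℝ) * θ⌋).toNat ≤ n := hyn
        omega
      have h1 : (m : ℝ) * θ < n + 1 := by
        have := Int.lt_floor_add_one ((m : ℝ) * θ)
        have h' : ((⌊(m : ℝ) * θ⌋ : ℤ) : ℝ) ≤ n := by exact_mod_cast hfl
        linarith
      have hmM : m ≤ M := by
        apply Nat.le_floor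
        rw [hθ, mul_one_div, div_lt_iff₀ h0] at h1
        exact h1.le
      have := Nat.lt_div_mul_add (a := M) r.den_pos
      rw [add_mul]; omega
    have hcard : countUpTo X n ≤ F.card := by
      unfold countUpTo
      refine (Set.ncard_le_ncard hsub (Finset.finite_toSet _)).trans ?_
      rw [Set.ncard_coe_finset]
      exact Finset.card_image_le
    have hb := aux_blocks θ c hc r hr (M / r.den + 1)
    have hMle : (M : ℝ) ≤ ((n : ℝ) + 1) * α := Nat.floor_le (by positivity)
    have hdiv : ((M / r.den : ℕ) : ℝ) ≤ ((n : ℝ) + 1) * α / q :=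
      Nat.cast_div_le.trans (by gcongr)
    calc (countUpTo X n : ℝ) ≤ F.card := by exact_mod_cast hcard
      _ ≤ _ := hb
      _ ≤ _ := by push_cast; gcongr
  have hlim : Tendsto (fun n : ℕ => ((α / q) * (q * c + 3)
      + (α / q + 1) * (q * c + 3) / (n : ℝ))) atTop (nhds ((α / q) * (q * c + 3) + 0)) :=
    tendsto_const_nhds.add (tendsto_const_div_atTop_nhds_zero_nat _)
  have hlt : (α / q) * (q * c + 3) + 0 < α * c + ε := by
    have : (α / q) * (q * c + 3) = α * c + 3 * α / q := by field_simp
    linarith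
  unfold upperDensity
  apply Filter.limsup_le_of_le
  · exact Filter.isCoboundedUnder_le_of_le atTop (x := 0) (fun n => by positivity)
  · filter_upwards [hlim.eventually_lt_const hlt, eventually_gt_atTop 0] with n hn hn0
    refine le_trans ?_ hn.le
    have hn0' : (0 : ℝ) < n := by exact_mod_cast hn0
    rw [div_le_iff₀ hn0']
    refine (key n).trans (le_of_eq ?_)
    field_simp
    ring

theorem stmt11 (α : ℝ) (hirr : Irrational α) (h0 : 0 < α) (h1 : α < 1)
    (θ : ℝ) (hθ : θ = 1 / α) (k : ℕ) (hk : 2 ≤ k) (A : Set ℕ)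
    (hA : A = (fun n : ℕ => (⌊(n : ℝ) * θ⌋).toNat) ''
      {n : ℕ | 0 < n ∧ Int.fract ((n : ℝ) * θ) < 1 / (k : ℝ)}) :
    ∀ j : ℕ, 2 ≤ j → j ≤ k →
      foldSum j A ⊆ (fun m : ℕ => (⌊(m : ℝ) * θ⌋).toNat) ''
          {m : ℕ | 0 < m ∧ Int.fract ((m : ℝ) * θ) < (j : ℝ) / k} ∧
      upperDensity (foldSum j A) ≤ (j : ℝ) * α / k := by
  intro j hj hjk
  have hk0 : (0 : ℝ) < k := by exact_mod_cast (by omega : 0 < k)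
  have hj0 : (0 : ℝ) < j := by exact_mod_cast (by omega : 0 < j)
  have hθ0 : 0 < θ := by rw [hθ]; positivity
  have hsub : foldSum j A ⊆ (fun m : ℕ => (⌊(m : ℝ) * θ⌋).toNat) ''
          {m : ℕ | 0 < m ∧ Int.fract ((m : ℝ) * θ) < (j : ℝ) / k} := by
    rintro y ⟨f, hf, rfl⟩
    subst hA
    choose g hg hgf using hf
    have hne : (Finset.univ : Finset (Fin j)).Nonempty := ⟨⟨0, by omega⟩, Finset.mem_univ _⟩
    have hfc : ∀ i, (f i : ℤ) = ⌊(g i : ℝ) * θ⌋ := by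
      intro i
      rw [← hgf i]
      exact Int.toNat_of_nonneg (Int.floor_nonneg.mpr (by positivity))
    set s : ℝ := ∑ i, Int.fract ((g i : ℝ) * θ) with hs
    have hs0 : 0 ≤ s := Finset.sum_nonneg fun i _ => Int.fract_nonneg _
    have hslt : s < j / k := by
      have : s < ∑ i : Fin j, 1 / (k : ℝ) := Finset.sum_lt_sum_of_nonempty hne fun i _ => (hg i).2
      simpa [div_eq_mul_inv] using this
    have hs1 : s < 1 := by
      refine hslt.trans_le ?_
      rw [div_le_one hk0]; exact_mod_cast hjk
    have hdec : ((∑ i, g i : ℕ) : ℝ) * θ = ((∑ i, f i : ℕ) : ℤ) + s := by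
      push_cast
      rw [Finset.sum_mul, hs, ← Finset.sum_add_distrib]
      refine Finset.sum_congr rfl fun i _ => ?_
      have h := Int.floor_add_fract ((g i : ℝ) * θ)
      rw [← hfc i] at h
      exact_mod_cast h.symm
    have hfs : Int.fract s = s := Int.fract_eq_self.mpr ⟨hs0, hs1⟩
    have hfl : ⌊s⌋ = 0 := Int.floor_eq_zero_iff.mpr ⟨hs0, hs1⟩
    refine ⟨∑ i, g i, ⟨Finset.sum_pos (fun i _ => (hg i).1) hne, ?_⟩, ?_⟩
    · rw [hdec, Int.fract_intCast_add, hfs]; exact hslt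
    · show (⌊((∑ i, g i : ℕ) : ℝ) * θ⌋).toNat = _
      rw [hdec, Int.floor_intCast_add, hfl, add_zero, Int.toNat_natCast]
  refine ⟨hsub, ?_⟩
  have := aux_count_s11 α θ (j / k) hirr h0 hθ (by positivity) _ hsub
  calc _ ≤ _ := this
    _ = _ := by ring
end

section
/- Let α be an irrational real number with 0 < α < 1, let θ := 1/α, let k ≥ 2 be an integer, and define A := {⌊nθ⌋ : n ∈ ℕ₊, {nθ} < 1/k}. Let j be an integer with 2 ≤ j ≤ k and let ε be a real number with 0 < ε < 1/(4k). Define B := {⌊Nθ⌋ : N ∈ ℕ₊, ε/2 ≤ {Nθ} < j/k − ε/2}. Then all but finitely many elements of B belong to the j-fold sumset jA; consequently, the lower asymptotic density of jA is at least α(j/k − ε). -/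
open Filter Pointwise

lemma net_pos (η : ℝ) (hη : 0 < η) : ∃ T : ℕ, ∀ y : ℝ, ∃ t : ℕ, 0 < t ∧ t ≤ T ∧
    ∃ z : ℤ, |(t : ℝ) * η - y - z| ≤ η := by
  refine ⟨⌊1 / η⌋₊ + 1, fun y => ⟨⌊Int.fract y / η⌋₊ + 1, by omega, ?_, -⌊y⌋, ?_⟩⟩
  · have : Int.fract y / η ≤ 1 / η := by
      gcongr
      exact (Int.fract_lt_one y).le
    have := Nat.floor_le_floor this
    omega
  · have h1 := Nat.floor_le (a := Int.fract y / η) (by have := Int.fract_nonneg y; positivity)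
    have h2 := Nat.lt_floor_add_one (Int.fract y / η)
    rw [le_div_iff₀ hη] at h1
    rw [div_lt_iff₀ hη] at h2
    have h3 := Int.floor_add_fract y
    push_cast
    rw [abs_le]
    constructor <;> linarith

lemma net (θ : ℝ) (hθ : Irrational θ) (δ : ℝ) (hδ : 0 < δ) : ∃ M : ℕ, ∀ y : ℝ, ∃ n : ℕ,
    0 < n ∧ n ≤ M ∧ ∃ z : ℤ, |(n : ℝ) * θ - y - z| < δ := by
  obtain ⟨r, hr⟩ := exists_nat_gt (1 / δ)
  have hr0 : (0 : ℝ) < r := lt_trans (by positivity) hr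
  obtain ⟨q, hq, -, h⟩ := Real.exists_nat_abs_mul_sub_round_le θ (n := r) (by exact_mod_cast hr0)
  set p := round ((q : ℝ) * θ)
  have hlt : |(q : ℝ) * θ - p| < δ := by
    refine lt_of_le_of_lt h ?_
    rw [div_lt_iff₀ (by positivity)]
    rw [div_lt_iff₀ hδ] at hr
    nlinarith
  have hne : (q : ℝ) * θ - p ≠ 0 := by
    have := (hθ.natCast_mul hq.ne').sub_intCast p
    exact this.ne_zero
  rcases lt_or_gt_of_ne hne with hneg | hpos
  · obtain ⟨T, hT⟩ := net_pos (-((q : ℝ) * θ - p)) (by linarith)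
    refine ⟨T * q, fun y => ?_⟩
    obtain ⟨t, ht, htT, z, hz⟩ := hT (-y)
    refine ⟨t * q, by positivity, by gcongr, t * p - z, ?_⟩
    rw [abs_lt] at hlt ⊢
    rw [abs_le] at hz
    push_cast
    constructor <;> nlinarith
  · obtain ⟨T, hT⟩ := net_pos ((q : ℝ) * θ - p) (by linarith)
    refine ⟨T * q, fun y => ?_⟩
    obtain ⟨t, ht, htT, z, hz⟩ := hT y
    refine ⟨t * q, by positivity, by gcongr, t * p + z, ?_⟩
    rw [abs_lt] at hlt ⊢
    rw [abs_le] at hz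
    push_cast
    constructor <;> nlinarith

lemma part1 (θ : ℝ) (hirr : Irrational θ) (hθ1 : 1 < θ) (k : ℕ) (hk : 2 ≤ k) (A : Set ℕ)
    (hA : A = (fun n : ℕ => (⌊(n : ℝ) * θ⌋).toNat) ''
      {n : ℕ | 0 < n ∧ Int.fract ((n : ℝ) * θ) < 1 / (k : ℝ)})
    (j : ℕ) (hj2 : 2 ≤ j) (hjk : j ≤ k)
    (ε : ℝ) (hε0 : 0 < ε) : ∃ N₀ : ℕ, ∀ N : ℕ, N₀ ≤ N → ε / 2 ≤ Int.fract ((N : ℝ) * θ) →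
        Int.fract ((N : ℝ) * θ) < (j : ℝ) / k - ε / 2 →
        (⌊(N : ℝ) * θ⌋).toNat ∈ foldSum j A := by
  have hj0 : (0 : ℝ) < j := by positivity
  have hk0 : (0 : ℝ) < k := by positivity
  obtain ⟨i, rfl⟩ : ∃ i, j = i + 1 := ⟨j - 1, by omega⟩
  set J : ℝ := ((i + 1 : ℕ) : ℝ) with hJ
  have hiJ : J = i + 1 := by simp [hJ]
  have hJ1 : 1 ≤ J := by rw [hiJ]; have : (0:ℝ) ≤ i := by positivity
                         linarith
  obtain ⟨M, hM⟩ := net θ hirr (ε / (2 * J ^ 2)) (by positivity)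
  refine ⟨i * M + 1, fun N hN hf1 hf2 => ?_⟩
  set f := Int.fract ((N : ℝ) * θ) with hf
  obtain ⟨n, hn, hnM, z, hz⟩ := hM (f / J)
  have hNn : i * n + 1 ≤ N := le_trans (by gcongr) hN
  have hJk : J / k ≤ 1 := by rw [div_le_one hk0, hJ]; exact Nat.cast_le.2 hjk
  set δ := ε / (2 * J ^ 2) with hδ
  have hδJ : δ * J ^ 2 = ε / 2 := by rw [hδ]; field_simp
  have hδ0 : 0 < δ := by positivity
  rw [abs_lt] at hz
  set g := (n : ℝ) * θ - z with hg
  set w := f / J with hw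
  have hfw : f = w * J := by rw [hw]; field_simp
  have hw1 : δ * J ≤ w := by
    rw [hw, le_div_iff₀ hj0]; nlinarith
  have hw2 : w + δ * J < 1 / k := by
    have : w < 1 / k - δ * J := by
      rw [hw, div_lt_iff₀ hj0]
      have : (1 / (k:ℝ) - δ * J) * J = J / k - δ * J ^ 2 := by ring
      rw [this]; linarith
    linarith
  have hk1 : 1 / (k : ℝ) ≤ 1 := by
    rw [div_le_one hk0]; exact_mod_cast (by omega : 1 ≤ k)
  have hδδ : δ ≤ δ * J := by nlinarith
  have hi0 : (0 : ℝ) ≤ i := by positivity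
  have hfl : ⌊(n : ℝ) * θ⌋ = z := by
    rw [Int.floor_eq_iff]; constructor <;> linarith
  have hfr : Int.fract ((n : ℝ) * θ) = g := by
    rw [Int.fract, hfl]
  have hN' := Int.floor_add_fract ((N : ℝ) * θ)
  rw [← hf] at hN'
  -- last one
  have hlast : ((N - i * n : ℕ) : ℝ) * θ = ((⌊(N : ℝ) * θ⌋ - i * z : ℤ) : ℝ) + (f - i * g) := by
    rw [Nat.cast_sub (by omega)]
    push_cast
    rw [hg]; linear_combination -hN'
  have hrest : f - i * g = w - i * (g - w) := by rw [hfw, hiJ]; ring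
  have hb1 : (i:ℝ) * (g - w) ≤ i * δ := by gcongr; linarith
  have hb2 : (i:ℝ) * (w - g) ≤ i * δ := by gcongr; linarith
  have hiδ : (i:ℝ) * δ < δ * J := by rw [hiJ]; nlinarith
  have hr0 : 0 ≤ f - i * g := by linarith
  have hr1 : f - i * g < 1 / k := by linarith
  have hfl2 : ⌊((N - i * n : ℕ) : ℝ) * θ⌋ = ⌊(N : ℝ) * θ⌋ - i * z := by
    rw [Int.floor_eq_iff, hlast]; constructor <;> linarith
  have hfr2 : Int.fract (((N - i * n : ℕ) : ℝ) * θ) = f - i * g := by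
    rw [Int.fract, hfl2, hlast]; ring
  have hz0 : 0 ≤ z := by rw [← hfl]; positivity
  have hy0 : 0 ≤ ⌊(N : ℝ) * θ⌋ - i * z := by rw [← hfl2]; positivity
  refine ⟨Fin.snoc (fun _ : Fin i => z.toNat) (⌊(N : ℝ) * θ⌋ - i * z).toNat, ?_, ?_⟩
  · intro a
    refine Fin.lastCases ?_ (fun a => ?_) a
    · simp only [Fin.snoc_last]
      rw [hA]
      refine ⟨N - i * n, ⟨by omega, ?_⟩, ?_⟩
      · rw [hfr2]; exact hr1
      · simp only [hfl2]
    · simp only [Fin.snoc_castSucc]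
      rw [hA]
      refine ⟨n, ⟨hn, ?_⟩, ?_⟩
      · rw [hfr]; linarith
      · simp only [hfl]
  · rw [Fin.sum_univ_castSucc]
    simp
    zify
    rw [Int.toNat_of_nonneg hz0, Int.toNat_of_nonneg hy0, Int.toNat_of_nonneg (by positivity)]
    ring

lemma shift_count (m : ℕ) (hm : 0 < m) (a b y : ℝ) (ha : 0 ≤ a) (hb : b ≤ 1) :
    (m : ℝ) * (b - a) - 1 ≤ (((Finset.range m).filter (fun s : ℕ =>
      a ≤ Int.fract (y + s / m) ∧ Int.fract (y + s / m) < b)).card : ℝ) := by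
  have hm0 : (0 : ℝ) < m := by positivity
  set lo := ⌈(m : ℝ) * (a - y)⌉ with hlo
  set hi := ⌈(m : ℝ) * (b - y)⌉ with hhi
  have key : (Finset.Ico lo hi).card ≤ ((Finset.range m).filter (fun s : ℕ =>
      a ≤ Int.fract (y + s / m) ∧ Int.fract (y + s / m) < b)).card := by
    have hmem : ∀ t ∈ Finset.Ico lo hi, a ≤ y + (t : ℝ) / m ∧ y + (t : ℝ) / m < b := by
      intro t ht
      rw [Finset.mem_Ico, hlo, hhi, Int.ceil_le, Int.lt_ceil] at ht
      have e : (t : ℝ) / m * m = t := by field_simp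
      constructor <;> nlinarith
    apply Finset.card_le_card_of_injOn (fun t : ℤ => (t % m).toNat)
    · intro t ht
      obtain ⟨h1, h2⟩ := hmem t ht
      have hz := Int.emod_nonneg t (b := (m : ℤ)) (by omega)
      have hl := Int.emod_lt_of_pos t (b := (m : ℤ)) (by omega)
      have hfr : Int.fract (y + ((t % m).toNat : ℝ) / m) = y + (t : ℝ) / m := by
        rw [Int.fract_eq_iff]
        refine ⟨by linarith, by linarith, -(t / m), ?_⟩
        have e1 : (((t % m).toNat : ℤ) : ℝ) = (t % m : ℤ) := by rw [Int.toNat_of_nonneg hz]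
        have e2 : ((t % m : ℤ) : ℝ) + m * (t / m : ℤ) = t := by
          exact_mod_cast Int.emod_add_mul_ediv t m
        rw [Int.cast_natCast] at e1
        rw [e1, ← e2]
        push_cast
        field_simp
        ring
      simp only [Finset.coe_filter, Finset.mem_range, Set.mem_ofPred_eq]
      rw [hfr]
      exact ⟨by omega, h1, h2⟩
    · intro t ht t' ht' htt
      obtain ⟨h1, h2⟩ := hmem t ht
      obtain ⟨h1', h2'⟩ := hmem t' ht'
      have hz := Int.emod_nonneg t (b := (m : ℤ)) (by omega)
      have hz' := Int.emod_nonneg t' (b := (m : ℤ)) (by omega)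
      simp only at htt
      have e : t % m = t' % m := by omega
      have hd : (t : ℝ) / m * m = t := by field_simp
      have hd' : (t' : ℝ) / m * m = t' := by field_simp
      have l1 : (t : ℝ) - t' < m := by nlinarith
      have l2 : (t' : ℝ) - t < m := by nlinarith
      have l1' : t - t' < m := by exact_mod_cast l1
      have l2' : t' - t < m := by exact_mod_cast l2
      obtain ⟨c, hc⟩ := Int.ModEq.dvd e
      have hc0 : c = 0 := by
        have : -1 < c := by nlinarith
        have : c < 1 := by nlinarith
        omega
      subst hc0
      linarith
  have h2 : (m : ℝ) * (b - a) - 1 ≤ ((Finset.Ico lo hi).card : ℝ) := by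
    rw [Int.card_Ico]
    have h1 : ((hi - lo : ℤ) : ℝ) ≤ ((hi - lo).toNat : ℝ) := by
      exact_mod_cast Int.self_le_toNat (hi - lo)
    have := Int.le_ceil ((m : ℝ) * (b - y))
    have := Int.ceil_lt_add_one ((m : ℝ) * (a - y))
    push_cast at h1
    linarith
  refine h2.trans ?_
  exact_mod_cast key

lemma equi (θ : ℝ) (hirr : Irrational θ) (a b η : ℝ) (ha : 0 ≤ a) (hb : b ≤ 1) (hη : 0 < η) :
    ∃ C : ℝ, ∀ X : ℕ, (b - a - η) * X - C ≤ (((Finset.Icc 1 X).filter (fun N : ℕ =>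
      a ≤ Int.fract ((N : ℝ) * θ) ∧ Int.fract ((N : ℝ) * θ) < b)).card : ℝ) := by
  obtain ⟨M, hM⟩ := net θ hirr (η / 3) (by positivity)
  obtain ⟨m, hm⟩ := exists_nat_gt (3 / η)
  have hm0 : (0 : ℝ) < m := lt_trans (by positivity) hm
  have hmη : 1 ≤ m * (η / 3) := by
    rw [div_lt_iff₀ hη] at hm; linarith
  choose n hn0 hnM z hz using hM
  set c : ℕ → ℕ := fun X => ((Finset.Icc 1 X).filter (fun N : ℕ =>
      a ≤ Int.fract ((N : ℝ) * θ) ∧ Int.fract ((N : ℝ) * θ) < b)).card with hc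
  have key : ∀ X : ℕ, (b - a - η) * X ≤ c (X + M) := by
    intro X
    let P : ℕ → ℕ → Prop := fun s N => a + η / 3 ≤ Int.fract ((N : ℝ) * θ + s / m) ∧
      Int.fract ((N : ℝ) * θ + s / m) < b - η / 3
    classical
    have h1 : ∀ s : ℕ, ((Finset.Icc 1 X).filter (fun N => P s N)).card ≤ c (X + M) := by
      intro s
      apply Finset.card_le_card_of_injOn (fun N => N + n (s / m))
      · intro N hN
        simp only [Finset.coe_filter, Finset.mem_Icc, Set.mem_ofPred_eq, P] at hN ⊢
        obtain ⟨⟨hN1, hNX⟩, hNa, hNb⟩ := hN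
        have hzz := hz (s / m)
        have := hnM (s / m)
        rw [abs_lt] at hzz
        have hfl := Int.floor_add_fract ((N : ℝ) * θ + s / m)
        have : Int.fract (((N + n (s / m) : ℕ) : ℝ) * θ) =
          Int.fract ((N : ℝ) * θ + s / m) + (n (s / m) * θ - s / m - z (s / m)) := by
          rw [Int.fract_eq_iff]
          refine ⟨by linarith, by linarith, ⌊(N : ℝ) * θ + s / m⌋ + z (s / m), ?_⟩
          push_cast
          linear_combination -hfl
        rw [this]
        refine ⟨⟨by omega, by omega⟩, by linarith, by linarith⟩
      · intro x _ y _ h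
        simpa using h
    have h2 : ∀ N : ℕ, (m : ℝ) * (b - a - η) ≤ ((Finset.range m).filter (fun s => P s N)).card := by
      intro N
      have := shift_count m (by exact_mod_cast hm0) (a + η / 3) (b - η / 3) ((N : ℝ) * θ)
        (by linarith) (by linarith)
      refine le_trans ?_ this
      nlinarith
    have h3 := Finset.sum_card_bipartiteAbove_eq_sum_card_bipartiteBelow
      (s := Finset.range m) (t := Finset.Icc 1 X) P
    simp only [Finset.bipartiteAbove, Finset.bipartiteBelow] at h3
    have h4 : ∑ s ∈ Finset.range m, ((Finset.Icc 1 X).filter (fun N => P s N)).card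
        ≤ m * c (X + M) := by
      have := Finset.sum_le_card_nsmul (Finset.range m) _ _ (fun s _ => h1 s)
      simpa using this
    have h5 : (X : ℝ) * (m * (b - a - η)) ≤
        ((∑ N ∈ Finset.Icc 1 X, ((Finset.range m).filter (fun s => P s N)).card : ℕ) : ℝ) := by
      push_cast
      have := Finset.card_nsmul_le_sum (Finset.Icc 1 X)
        (fun N => (((Finset.range m).filter (fun s => P s N)).card : ℝ)) _ (fun N _ => h2 N)
      simpa using this
    rw [← h3] at h5
    have h6 : (X : ℝ) * (m * (b - a - η)) ≤ m * c (X + M) := h5.trans (by exact_mod_cast h4)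
    have : m * ((b - a - η) * X) ≤ m * (c (X + M) : ℝ) := by linarith
    exact le_of_mul_le_mul_left this hm0
  refine ⟨M, fun X => ?_⟩
  change _ ≤ (c X : ℝ)
  rcases le_total M X with h | h
  · obtain ⟨Y, rfl⟩ := Nat.exists_eq_add_of_le' h
    have := key Y
    push_cast
    have hM0 : (0 : ℝ) ≤ M := by positivity
    nlinarith
  · have hX : (X : ℝ) ≤ M := by exact_mod_cast h
    have hX0 : (0 : ℝ) ≤ X := by positivity
    have : (0 : ℝ) ≤ c X := by positivity
    nlinarith

theorem stmt12 (α : ℝ) (hirr : Irrational α) (h0 : 0 < α) (h1 : α < 1)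
    (θ : ℝ) (hθ : θ = 1 / α) (k : ℕ) (hk : 2 ≤ k) (A : Set ℕ)
    (hA : A = (fun n : ℕ => (⌊(n : ℝ) * θ⌋).toNat) ''
      {n : ℕ | 0 < n ∧ Int.fract ((n : ℝ) * θ) < 1 / (k : ℝ)})
    (j : ℕ) (hj2 : 2 ≤ j) (hjk : j ≤ k)
    (ε : ℝ) (hε0 : 0 < ε) (hε1 : ε < 1 / (4 * (k : ℝ))) (B : Set ℕ)
    (hB : B = (fun N : ℕ => (⌊(N : ℝ) * θ⌋).toNat) ''
      {N : ℕ | 0 < N ∧ ε / 2 ≤ Int.fract ((N : ℝ) * θ) ∧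
        Int.fract ((N : ℝ) * θ) < (j : ℝ) / k - ε / 2}) :
    (B \ foldSum j A).Finite ∧
    α * ((j : ℝ) / k - ε) ≤ lowerDensity (foldSum j A) := by
  have hirr' : Irrational θ := by rw [hθ, one_div]; exact hirr.inv
  have hθ1 : 1 < θ := by rw [hθ, one_div]; exact (one_lt_inv₀ h0).2 h1
  have hαθ : α * θ = 1 := by rw [hθ]; field_simp
  have hk0 : (0 : ℝ) < k := by positivity
  have hJk : (j : ℝ) / k ≤ 1 := by rw [div_le_one hk0]; exact_mod_cast hjk
  constructor
  · obtain ⟨N₀, hN₀⟩ := part1 θ hirr' hθ1 k hk A hA j hj2 hjk ε hε0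
    refine ((Set.finite_Iio N₀).image (fun N : ℕ => (⌊(N : ℝ) * θ⌋).toNat)).subset ?_
    rintro x ⟨hx, hxA⟩
    rw [hB] at hx
    obtain ⟨N, ⟨hN, hf1, hf2⟩, rfl⟩ := hx
    refine ⟨N, ?_, rfl⟩
    by_contra hlt
    exact hxA (hN₀ N (by simpa using hlt) hf1 hf2)
  · obtain ⟨N₀, hN₀⟩ := part1 θ hirr' hθ1 k hk A hA j hj2 hjk (ε / 2) (by positivity)
    obtain ⟨C, hC⟩ := equi θ hirr' (ε / 2 / 2) (j / k - ε / 2 / 2) (ε / 4) (by positivity)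
      (by linarith) (by positivity)
    have hcount : ∀ n : ℕ, α * (j / k - 3 * ε / 4) * n - (C + 1 + N₀) ≤
        countUpTo (foldSum j A) n := by
      intro n
      have hX := hC ⌊α * n⌋₊
      set X := ⌊α * n⌋₊ with hXdef
      set S := (Finset.Icc 1 X).filter (fun N : ℕ =>
        ε / 2 / 2 ≤ Int.fract ((N : ℝ) * θ) ∧ Int.fract ((N : ℝ) * θ) < j / k - ε / 2 / 2) with hS
      have hXle : (X : ℝ) ≤ α * n := Nat.floor_le (by positivity)
      have hXgt : α * n < X + 1 := Nat.lt_floor_add_one _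
      have hcard : (S \ Finset.range N₀).card ≤ countUpTo (foldSum j A) n := by
        rw [countUpTo, ← Set.ncard_coe_finset]
        apply Set.ncard_le_ncard_of_injOn (fun N : ℕ => (⌊(N : ℝ) * θ⌋).toNat)
        · intro N hN
          simp only [hS, Finset.coe_sdiff, Finset.coe_filter, Finset.mem_Icc, Set.mem_sdiff,
            Set.mem_ofPred_eq, Finset.coe_range, Set.mem_Iio, not_lt] at hN
          obtain ⟨⟨⟨hN1, hNX⟩, hf1, hf2⟩, hNN⟩ := hN
          refine ⟨hN₀ N hNN hf1 hf2, ?_, ?_⟩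
          · have : (1 : ℤ) ≤ ⌊(N : ℝ) * θ⌋ := by
              rw [Int.le_floor]
              have : (1 : ℝ) ≤ N := by exact_mod_cast hN1
              push_cast
              nlinarith
            show 1 ≤ (⌊(N : ℝ) * θ⌋).toNat
            omega
          · have : ⌊(N : ℝ) * θ⌋ ≤ n := by
              have : (N : ℝ) * θ ≤ n := by
                have h3 : (N : ℝ) ≤ α * n := le_trans (by exact_mod_cast hNX) hXle
                calc (N : ℝ) * θ ≤ α * n * θ := by gcongr
                  _ = n := by rw [mul_right_comm, hαθ, one_mul]
              have h4 := (Int.floor_le ((N : ℝ) * θ)).trans this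
              exact_mod_cast h4
            show (⌊(N : ℝ) * θ⌋).toNat ≤ n
            omega
        · have hmono : StrictMono (fun N : ℕ => (⌊(N : ℝ) * θ⌋).toNat) := by
            apply strictMono_nat_of_lt_succ
            intro N
            have e : ⌊(N : ℝ) * θ⌋ + 1 ≤ ⌊((N + 1 : ℕ) : ℝ) * θ⌋ := by
              rw [Int.le_floor]
              have := Int.floor_le ((N : ℝ) * θ)
              push_cast
              linarith
            have : 0 ≤ ⌊(N : ℝ) * θ⌋ := by positivity
            show (⌊(N : ℝ) * θ⌋).toNat < (⌊((N + 1 : ℕ) : ℝ) * θ⌋).toNat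
            omega
          exact hmono.injective.injOn
      have hsd : S.card ≤ (S \ Finset.range N₀).card + N₀ := by
        have := Finset.le_card_sdiff (Finset.range N₀) S
        simp only [Finset.card_range] at this
        omega
      have hcS : (S.card : ℝ) ≤ countUpTo (foldSum j A) n + N₀ := by
        exact_mod_cast hsd.trans (by omega)
      have hβ : (j : ℝ) / k - 3 * ε / 4 ≤ 1 := by linarith
      have hβ0 : 0 ≤ (j : ℝ) / k - 3 * ε / 4 := by
        have : 2 / (k : ℝ) ≤ j / k := by gcongr; exact_mod_cast hj2
        have e : 1 / (4 * (k : ℝ)) = (2 / k) / 8 := by field_simp; norm_num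
        rw [e] at hε1
        linarith
      have : ((j : ℝ) / k - 3 * ε / 4) * (α * n) ≤ ((j : ℝ) / k - 3 * ε / 4) * (X + 1) := by
        gcongr
      have e : (j : ℝ) / k - ε / 2 / 2 - ε / 2 / 2 - ε / 4 = j / k - 3 * ε / 4 := by ring
      rw [e] at hX
      linarith
    rw [lowerDensity]
    apply le_liminf_of_le
    · apply IsBoundedUnder.isCoboundedUnder_ge
      refine ⟨1, ?_⟩
      simp only [eventually_map]
      refine Eventually.of_forall fun n => ?_
      apply div_le_one_of_le₀ _ (by positivity)
      have : countUpTo (foldSum j A) n ≤ n := by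
        rw [countUpTo]
        refine (Set.ncard_le_ncard Set.inter_subset_right (Set.finite_Icc 1 n)).trans ?_
        rw [← Finset.coe_Icc, Set.ncard_coe_finset, Nat.card_Icc, Nat.add_sub_cancel]
      exact_mod_cast this
    · obtain ⟨n₀, hn₀⟩ := exists_nat_gt ((C + 1 + N₀) / (α * (ε / 4)))
      filter_upwards [eventually_ge_atTop (max n₀ 1)] with n hn
      have hn1 : 1 ≤ n := le_trans (le_max_right _ _) hn
      have hn2 : n₀ ≤ n := le_trans (le_max_left _ _) hn
      have hn2' : (n₀ : ℝ) ≤ n := by exact_mod_cast hn2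
      have hnpos : (0 : ℝ) < n := by exact_mod_cast hn1
      rw [le_div_iff₀ hnpos]
      have h5 := hn₀.trans_le hn2'
      rw [div_lt_iff₀ (by positivity)] at h5
      have := hcount n
      nlinarith
end
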